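/- arXiv:math/9507219 — 3 statements merged into one kernel-verified Lean document; each statement's English description precedes it below -/
import Mathlib

section
/- Let G be a 2-connected undirected graph that is not an odd cycle and does not contain two vertices joined by three internally disjoint paths one of which has even length. Then the symmetric digraph G* is noneven, i.e., there is an assignment of weights 0,1 to the arcs of G* under which every directed cycle has odd total weight. -/
open Matrix

/-- `c` traces a directed cycle of length `m+1` in the digraph `R`:
distinct vertices, consecutive arcs (indices wrap around in `Fin (m+1)`). -/
def DicycleOn {V : Type*} {m : ℕ} (R : V → V → Prop) (c : Fin (m+1) → V) : Prop :=
  Function.Injective c ∧ ∀ i, R (c i) (c (i+1))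

/-- A digraph is noneven if some 0,1-weighting (valued in `ZMod 2`) of its arcs makes
every directed cycle have odd total weight. -/
def IsNoneven {V : Type*} (R : V → V → Prop) : Prop :=
  ∃ w : V → V → ZMod 2, ∀ (m : ℕ) (c : Fin (m+1) → V),
    DicycleOn R c → ∑ i, w (c i) (c (i+1)) = 1

/-- A digraph is even if every 0,1-weighting of its arcs admits a directed cycle
of even total weight. -/
def IsEvenDigraph {V : Type*} (R : V → V → Prop) : Prop :=
  ∀ w : V → V → ZMod 2, ∃ (m : ℕ) (c : Fin (m+1) → V),
    DicycleOn R c ∧ ∑ i, w (c i) (c (i+1)) = 0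

def StronglyConnected {V : Type*} (R : V → V → Prop) : Prop :=
  ∀ u v, Relation.ReflTransGen R u v

/-- Removing any single vertex leaves a strongly connected digraph. -/
def StronglyTwoConnected {V : Type*} (R : V → V → Prop) : Prop :=
  ∀ x : V, StronglyConnected (fun a b : {y : V // y ≠ x} => R a b)

def SemiComplete {V : Type*} (R : V → V → Prop) : Prop :=
  ∀ u v : V, u ≠ v → R u v ∨ R v u

/-- The digraph W₄: double arcs 0↔1 and 2↔3, single arcs 0→2, 2→1, 1→3, 3→0
(the unique 2-connected semi-complete noneven digraph on 4 vertices; every vertex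
has indegree 2 and outdegree 2 and there are 8 arcs). -/
def W4 : Fin 4 → Fin 4 → Prop := fun u v =>
  (u = 0 ∧ v = 1) ∨ (u = 1 ∧ v = 0) ∨ (u = 2 ∧ v = 3) ∨ (u = 3 ∧ v = 2) ∨
  (u = 0 ∧ v = 2) ∨ (u = 2 ∧ v = 1) ∨ (u = 1 ∧ v = 3) ∨ (u = 3 ∧ v = 0)

/-- The symmetric double 4-cycle C₄*. -/
def C4star : Fin 4 → Fin 4 → Prop := fun u v => v = u + 1 ∨ u = v + 1

def DigraphIso {V W : Type*} (R : V → V → Prop) (S : W → W → Prop) : Prop :=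
  ∃ e : V ≃ W, ∀ u v, R u v ↔ S (e u) (e v)

/-- A sign pattern: entries in {-1, 0, 1}. -/
def IsSignPattern {I : Type*} (H : Matrix I I ℝ) : Prop :=
  ∀ i j, H i j = -1 ∨ H i j = 0 ∨ H i j = 1

/-- `A ∈ Q(H)`: the matrix `A` has sign pattern `H`. -/
def HasSignPattern {I : Type*} (A H : Matrix I I ℝ) : Prop :=
  ∀ i j, Real.sign (A i j) = H i j

/-- `Q(H)` contains a symplectic pair `(A, D)` with `Aᵀ D = I`. -/
def AllowsSymplecticPairs {I : Type*} [Fintype I] [DecidableEq I] (H : Matrix I I ℝ) : Prop :=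
  ∃ A D : Matrix I I ℝ, HasSignPattern A H ∧ HasSignPattern D H ∧ Aᵀ * D = 1

def IsSignNonsingular {I : Type*} [Fintype I] [DecidableEq I] (H : Matrix I I ℝ) : Prop :=
  ∀ A : Matrix I I ℝ, HasSignPattern A H → A.det ≠ 0

def NegativeDiagonal {I : Type*} (H : Matrix I I ℝ) : Prop := ∀ i, H i i = -1

/-- The (unweighted) digraph of the pattern `H` is `R`: an arc `(i,j)`, `i ≠ j`,
exactly for the off-diagonal nonzero entries. -/
def PatternDigraph {I : Type*} (H : Matrix I I ℝ) (R : I → I → Prop) : Prop :=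
  ∀ i j, i ≠ j → (H i j ≠ 0 ↔ R i j)

/-- An unweighted digraph allows symplectic pairs if some negative-diagonal sign
pattern whose digraph is `R` allows symplectic pairs. -/
def DigraphAllowsSymplecticPairs {V : Type*} [Fintype V] [DecidableEq V]
    (R : V → V → Prop) : Prop :=
  ∃ H : Matrix V V ℝ, IsSignPattern H ∧ NegativeDiagonal H ∧
    PatternDigraph H R ∧ AllowsSymplecticPairs H

/-- Tree edges of the caterpillar tree underlying an extended caterpillar:
consecutive backbone vertices, and blossom vertices joined to their backbone vertex.
`pos` is the blossom (backbone) index of a vertex, `bb j` the backbone vertex of index `j`. -/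
def CaterpillarTreeEdge {n : ℕ} (pos : Fin n → ℕ) (bb : ℕ → Fin n) (u v : Fin n) : Prop :=
  u ≠ v ∧ ((u = bb (pos u) ∧ v = bb (pos v) ∧ (pos v = pos u + 1 ∨ pos u = pos v + 1)) ∨
           (pos u = pos v ∧ (u = bb (pos u) ∨ v = bb (pos v))))

/-- `R` is an extended caterpillar on `Fin n`, where the natural order of `Fin n`
is the backbone-induced total order: there are `k` blossoms (`pos` monotone, surjective
onto `{0, …, k-1}` with backbone vertices `bb j`); the first and last blossoms are
trivial (no blossom vertices at the ends of the backbone); and the arcs are: one arc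
`u → v` for every pair `v < u`, together with both arcs of every tree edge. -/
def IsExtendedCaterpillar {n : ℕ} (R : Fin n → Fin n → Prop) : Prop :=
  ∃ (k : ℕ) (pos : Fin n → ℕ) (bb : ℕ → Fin n),
    0 < k ∧ Monotone pos ∧ (∀ v, pos v < k) ∧ (∀ j, j < k → pos (bb j) = j) ∧
    (∀ v, pos v = 0 → v = bb 0) ∧ (∀ v, pos v = k - 1 → v = bb (k - 1)) ∧
    (∀ u v, R u v ↔ (v < u ∨ (u < v ∧ CaterpillarTreeEdge pos bb u v)))

/-- Digraphs obtainable from the symmetric double cycle `C_k*` by subdividing arcs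
and splitting vertices (the weak k-double-cycles). -/
inductive WeakDoubleCycle : (k : ℕ) → (V : Type) → (V → V → Prop) → Prop where
  | base (m : ℕ) : WeakDoubleCycle (m+1) (Fin (m+1)) (fun u v => v = u + 1 ∨ u = v + 1)
  | subdivide {k : ℕ} {V : Type} {R : V → V → Prop} (a b : V) (hab : R a b)
      (h : WeakDoubleCycle k V R) :
      WeakDoubleCycle k (Option V) (fun x y =>
        (x = some a ∧ y = none) ∨ (x = none ∧ y = some b) ∨
        (∃ u v, x = some u ∧ y = some v ∧ R u v ∧ ¬(u = a ∧ v = b)))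
  | split {k : ℕ} {V : Type} {R : V → V → Prop} (a : V) (h : WeakDoubleCycle k V R) :
      WeakDoubleCycle k (Option V) (fun x y =>
        (x = some a ∧ y = none) ∨
        (∃ v, x = none ∧ y = some v ∧ R a v) ∨
        (∃ u v, x = some u ∧ y = some v ∧ R u v ∧ u ≠ a))

/-- C₄-cockades: start with the 4-cycle; repeatedly pick an edge `(u,v)`, add two new
vertices `u', v'` and the edges `(u,u')`, `(u',v')`, `(v',v)`. -/
inductive IsC4Cockade : (V : Type) → SimpleGraph V → Prop where
  | base : IsC4Cockade (Fin 4) (SimpleGraph.fromRel (fun u v => v = u + 1))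
  | attach {V : Type} {G : SimpleGraph V} (u v : V) (huv : G.Adj u v)
      (h : IsC4Cockade V G) :
      IsC4Cockade (V ⊕ Fin 2)
        (SimpleGraph.fromRel (fun x y =>
          (∃ a b, x = Sum.inl a ∧ y = Sum.inl b ∧ G.Adj a b) ∨
          (x = Sum.inl u ∧ y = Sum.inr 0) ∨ (x = Sum.inr 0 ∧ y = Sum.inr 1) ∨
          (x = Sum.inr 1 ∧ y = Sum.inl v)))

/-- `G` is 2-connected: connected, and removing any single vertex leaves it connected. -/
def GraphTwoConnected {V : Type*} (G : SimpleGraph V) : Prop :=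
  G.Connected ∧ ∀ v : V, (G.induce {u | u ≠ v}).Connected

namespace ST4
open SimpleGraph

variable {V : Type}

/-- weight of a walk -/
def wt (w : V → V → ZMod 2) {G : SimpleGraph V} : {u v : V} → G.Walk u v → ZMod 2
  | _, _, .nil => 0
  | _, _, .cons (u := a) (v := b) _ p => w a b + wt w p

@[simp] lemma wt_nil (w : V → V → ZMod 2) {G : SimpleGraph V} (u : V) :
    wt w (Walk.nil : G.Walk u u) = 0 := rfl

@[simp] lemma wt_cons (w : V → V → ZMod 2) {G : SimpleGraph V} {a b c : V} (h : G.Adj a b)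
    (p : G.Walk b c) : wt w (Walk.cons h p) = w a b + wt w p := rfl

@[simp] lemma wt_append (w : V → V → ZMod 2) {G : SimpleGraph V} {a b c : V} (p : G.Walk a b)
    (q : G.Walk b c) : wt w (p.append q) = wt w p + wt w q := by
  induction p with
  | nil => simp
  | cons h p ih => simp [ih, add_assoc]

lemma wt_reverse (w : V → V → ZMod 2) {G : SimpleGraph V}
    (hw : ∀ a b, G.Adj a b → w a b + w b a = 1) {a b : V} (p : G.Walk a b) :
    wt w p + wt w p.reverse = p.length := by
  induction p with
  | nil => simp
  | @cons a b c h p ih =>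
    simp only [wt_cons, Walk.reverse_cons, wt_append, Walk.length_cons, wt_nil]
    push_cast
    rw [← ih, ← hw a b h]; ring

lemma wt_transfer (w w' : V → V → ZMod 2) {G H : SimpleGraph V} {a b : V} (p : G.Walk a b)
    (hp : ∀ e ∈ p.edges, e ∈ H.edgeSet) (hw : ∀ a b, H.Adj a b → w a b = w' a b) :
    wt w' (p.transfer H hp) = wt w p := by
  induction p with
  | nil => simp [Walk.transfer]
  | @cons a b c h p ih =>
    have : H.Adj a b := hp s(a,b) (by simp)
    rw [wt_cons, hw a b this, ← ih (fun e he => hp e (by simp [he]))]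
    rfl

/-- good weighting -/
def Good (G : SimpleGraph V) (w : V → V → ZMod 2) : Prop :=
  ∀ x y, G.Adj y x → ∀ Q : G.Walk x y, Q.IsPath → wt w Q + w y x = 1

def OddP (G : SimpleGraph V) : Prop :=
  ∀ x y, G.Adj y x → ∀ Q : G.Walk x y, Q.IsPath → Odd Q.length

def Theta (G : SimpleGraph V) : Prop :=
  ∃ (u v : V) (_ : u ≠ v) (p₁ p₂ p₃ : G.Walk u v),
        p₁.IsPath ∧ p₂.IsPath ∧ p₃.IsPath ∧ p₁ ≠ p₂ ∧ p₁ ≠ p₃ ∧ p₂ ≠ p₃ ∧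
        (∀ x, x ∈ p₁.support → x ∈ p₂.support → x = u ∨ x = v) ∧
        (∀ x, x ∈ p₁.support → x ∈ p₃.support → x = u ∨ x = v) ∧
        (∀ x, x ∈ p₂.support → x ∈ p₃.support → x = u ∨ x = v) ∧
        (Even p₁.length ∨ Even p₂.length ∨ Even p₃.length)

lemma Theta.mono {G H : SimpleGraph V} (h : H ≤ G) (hH : Theta H) : Theta G := by
  obtain ⟨u, v, huv, p₁, p₂, p₃, h1, h2, h3, h12, h13, h23, d12, d13, d23, he⟩ := hH
  have inj : Function.Injective (fun p : H.Walk u v => p.mapLe h) :=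
    Walk.map_injective_of_injective (f := Hom.ofLE h) Function.injective_id u v
  refine ⟨u, v, huv, p₁.mapLe h, p₂.mapLe h, p₃.mapLe h, h1.mapLe h, h2.mapLe h, h3.mapLe h,
    inj.ne h12, inj.ne h13, inj.ne h23, ?_⟩
  simp only [Walk.support_mapLe_eq_support, Walk.length_mapLe]
  exact ⟨d12, d13, d23, he⟩

lemma OddP.mono {G H : SimpleGraph V} (h : H ≤ G) (hG : OddP G) : OddP H := by
  intro x y hxy Q hQ
  have := hG x y (h hxy) (Q.mapLe h) (hQ.mapLe h)
  simpa only [Walk.length_mapLe] using this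

lemma first_hit {G : SimpleGraph V} (s : V → Prop) {a b : V} (p : G.Walk a b) (hb : s b) :
    ∃ (y : V) (q : G.Walk a y) (r : G.Walk y b), p = q.append r ∧ s y ∧
      ∀ x ∈ q.support, s x → x = y := by
  induction p with
  | nil => exact ⟨_, .nil, .nil, rfl, hb, by simp⟩
  | @cons a c b h p ih =>
    by_cases ha : s a
    · exact ⟨a, .nil, .cons h p, rfl, ha, by simp⟩
    · obtain ⟨y, q, r, rfl, hy, hq⟩ := ih hb
      refine ⟨y, .cons h q, r, rfl, hy, ?_⟩
      intro x hx hs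
      simp only [Walk.support_cons, List.mem_cons] at hx
      rcases hx with rfl | hx
      · exact absurd hs ha
      · exact hq x hx hs

lemma isPath_append {G : SimpleGraph V} {a b c : V} (p : G.Walk a b) (q : G.Walk b c) :
    (p.append q).IsPath ↔ p.IsPath ∧ q.IsPath ∧ ∀ x ∈ p.support, x ∈ q.support → x = b := by
  have hq : q.support = b :: q.support.tail := by simp
  rw [Walk.isPath_def, Walk.isPath_def, Walk.isPath_def, Walk.support_append,
    List.nodup_append]
  constructor
  · rintro ⟨h1, h2, h3⟩
    refine ⟨h1, ?_, ?_⟩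
    · rw [hq, List.nodup_cons]
      refine ⟨fun hb => h3 b (by simp) b hb rfl, h2⟩
    · intro x hx hx'
      rw [hq, List.mem_cons] at hx'
      rcases hx' with h | h
      · exact h
      · exact absurd rfl (h3 x hx x h)
  · rintro ⟨h1, h2, h3⟩
    rw [hq, List.nodup_cons] at h2
    refine ⟨h1, h2.2, ?_⟩
    rintro x hx y hy rfl
    have := h3 x hx (by rw [hq]; exact List.mem_cons_of_mem _ hy)
    subst this
    exact h2.1 hy

/-- Key lemma: paths between the ends of a deleted edge have the same weight. -/
lemma key {G H : SimpleGraph V} (hle : H ≤ G) (w : V → V → ZMod 2)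
    (hT : ¬ Theta G) (hw : Good H w) {u v : V} (huv : G.Adj u v) (hnot : ¬ H.Adj u v) (n : ℕ) :
    ∀ (z : V) (P : H.Walk u z) (A B : H.Walk z v), B.length ≤ n → (P.append A).IsPath →
      (P.append B).IsPath → wt w A = wt w B := by
  have hw1 : ∀ a b, H.Adj a b → w a b + w b a = 1 := by
    intro a b hab
    have := hw a b hab.symm (.cons hab .nil) (by simp [hab.ne])
    simpa using this
  induction n with
  | zero =>
    intro z P A B hB hA' hB'
    cases B with
    | nil =>
      have := (isPath_append _ _).1 hA'
      have hA := (Walk.isPath_iff_nil.1 this.2.1).eq_nil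
      subst hA; rfl
    | cons h B => simp at hB
  | succ n ih =>
    intro z P A B hB hA' hB'
    obtain ⟨pP, pA, dPA⟩ := (isPath_append _ _).1 hA'
    cases B with
    | nil =>
      have hA := (Walk.isPath_iff_nil.1 pA).eq_nil
      subst hA; rfl
    | @cons _ b _ h B =>
      obtain ⟨-, pB, dPB⟩ := (isPath_append _ _).1 hB'
      obtain ⟨y, S, B', rfl, hy, hS⟩ := first_hit (fun x => x ∈ A.support) B (by simp)
      obtain ⟨A1, A2, rfl⟩ := Walk.mem_support_iff_exists_append.1 hy
      obtain ⟨pA1, pA2, dA⟩ := (isPath_append _ _).1 pA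
      rw [Walk.cons_isPath_iff] at pB
      obtain ⟨pB, hz⟩ := pB
      obtain ⟨pS, pB', dS⟩ := (isPath_append _ _).1 pB
      simp only [Walk.mem_support_append_iff, Walk.support_cons, List.mem_cons, not_or] at *
      have hzy : z ≠ y := by rintro rfl; exact hz.1 (by simp)
      have hzS : z ∉ S.support := hz.1
      have hzA2 : z ∉ A2.support := fun hh => hzy (dA z (by simp) hh)
      -- cycle equation
      have cyc : wt w S + wt w A1.reverse + w z b = 1 := by
        have := hw b z h (S.append A1.reverse) (by
          rw [isPath_append]
          refine ⟨pS, pA1.reverse, ?_⟩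
          intro x hx hx'
          rw [Walk.support_reverse, List.mem_reverse] at hx'
          exact hS x hx (Or.inl hx'))
        simpa using this
      have hrev := wt_reverse w hw1 A1
      have pcS : (Walk.cons h S).IsPath := by
        rw [Walk.cons_isPath_iff]; exact ⟨pS, hzS⟩
      have eq1 : wt w A1 = wt w (Walk.cons h S) := by
        by_cases hEq : A1 = Walk.cons h S
        · rw [hEq]
        · have hodd : Odd A1.length := by
            by_contra hne
            rw [Nat.not_odd_iff_even] at hne
            apply hT
            have hd : s(u,v) ∉ H.edgeSet := hnot
            let T : G.Walk z y :=
              (P.reverse.mapLe hle).append (Walk.cons huv (A2.reverse.mapLe hle))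
            have hTs : ∀ x, x ∈ T.support ↔ x ∈ P.support ∨ x ∈ A2.support := by
              intro x
              simp only [T, Walk.mem_support_append_iff, Walk.support_mapLe_eq_support,
                Walk.support_cons, List.mem_cons, Walk.support_reverse, List.mem_reverse]
              have : u ∈ P.support := by simp
              constructor
              · rintro (h | rfl | h) <;> tauto
              · tauto
            have hTe : s(u,v) ∈ T.edges := by simp [T]
            have inj : Function.Injective (fun p : H.Walk z y => p.mapLe hle) :=
              Walk.map_injective_of_injective (f := Hom.ofLE hle) Function.injective_id z y
            have hneT : ∀ p : H.Walk z y, p.mapLe hle ≠ T := by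
              intro p hp
              rw [← hp, Walk.edges_mapLe_eq_edges] at hTe
              exact hd (p.edges_subset_edgeSet hTe)
            have hPA2 : ∀ x, x ∈ P.support → x ∈ A2.support → False := by
              intro x hx hx'
              have := dPA x hx (Or.inr hx')
              subst this; exact hzA2 hx'
            have pT : T.IsPath := by
              rw [isPath_append, Walk.cons_isPath_iff]
              refine ⟨pP.reverse.mapLe hle, ⟨pA2.reverse.mapLe hle, ?_⟩, ?_⟩
              · simp only [Walk.support_mapLe_eq_support, Walk.support_reverse, List.mem_reverse]
                exact fun hh => hPA2 u (by simp) hh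
              · simp only [Walk.support_mapLe_eq_support, Walk.support_reverse, List.mem_reverse,
                  Walk.support_cons, List.mem_cons]
                rintro x hx (rfl | hx')
                · rfl
                · exact (hPA2 x hx hx').elim
            refine ⟨z, y, hzy, A1.mapLe hle, (Walk.cons h S).mapLe hle, T, pA1.mapLe hle,
              pcS.mapLe hle, pT, inj.ne hEq, hneT _, hneT _, ?_, ?_, ?_, ?_⟩
            · simp only [Walk.support_mapLe_eq_support, Walk.support_cons, List.mem_cons]
              rintro x hx (rfl | hx')
              · left; rfl
              · right; exact hS x hx' (Or.inl hx)
            · simp only [Walk.support_mapLe_eq_support, hTs]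
              rintro x hx (hx' | hx')
              · left; exact dPA x hx' (Or.inl hx)
              · right; exact dA x hx hx'
            · simp only [Walk.support_mapLe_eq_support, hTs, Walk.support_cons, List.mem_cons]
              rintro x (rfl | hx) (hx' | hx')
              · left; rfl
              · left; rfl
              · left; exact dPB x hx' (Or.inr (Or.inl hx))
              · right; exact hS x hx (Or.inr hx')
            · left; rw [Walk.length_mapLe]; exact hne
          have h1 : (A1.length : ZMod 2) = 1 := by
            rw [ZMod.natCast_eq_one_iff_odd]; exact hodd
          rw [h1, ← cyc] at hrev
          rw [wt_cons]
          linear_combination hrev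
      have := ih y (P.append (Walk.cons h S)) A2 B' (by
          simp only [Walk.length_cons, Walk.length_append] at hB; omega)
        (by
          rw [isPath_append, isPath_append]
          refine ⟨⟨pP, pcS, ?_⟩, pA2, ?_⟩
          · intro x hx hx'
            simp only [Walk.support_cons, List.mem_cons] at hx'
            exact dPB x hx (by tauto)
          · intro x hx hx'
            simp only [Walk.mem_support_append_iff, Walk.support_cons, List.mem_cons] at hx
            rcases hx with hx | rfl | hx
            · have := dPA x hx (Or.inr hx')
              subst this; exact absurd hx' hzA2
            · exact absurd hx' hzA2
            · exact hS x hx (Or.inr hx'))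
        (by
          rw [← Walk.append_assoc]; exact hB')
      simp only [wt_append, wt_cons] at *
      rw [eq1, this]; ring


lemma split_dart {G : SimpleGraph V} {a b u v : V} (p : G.Walk a b) (he : s(u,v) ∈ p.edges) :
    ∃ (x y : V) (h : G.Adj x y) (A : G.Walk a x) (B : G.Walk y b),
      p = A.append (.cons h B) ∧ ((x = u ∧ y = v) ∨ (x = v ∧ y = u)) := by
  induction p with
  | nil => simp at he
  | @cons a c b h p ih =>
    rw [Walk.edges_cons, List.mem_cons] at he
    rcases he with he | he
    · refine ⟨a, c, h, .nil, p, rfl, ?_⟩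
      rw [Sym2.eq_iff] at he
      tauto
    · obtain ⟨x, y, h', A, B, rfl, hh⟩ := ih he
      exact ⟨x, y, h', .cons h A, B, rfl, hh⟩

lemma step {G : SimpleGraph V} (hT : ¬ Theta G) (hO : OddP G) {u v : V} (huv : G.Adj u v)
    (w : V → V → ZMod 2) (hw : Good (G.deleteEdges {s(u,v)}) w) : ∃ w', Good G w' := by
  classical
  set H := G.deleteEdges {s(u,v)} with hH
  have hle : H ≤ G := G.deleteEdges_le _
  have hnot : ¬ H.Adj u v := by simp [hH]
  have hHe : ∀ e, e ∈ H.edgeSet ↔ e ∈ G.edgeSet ∧ e ≠ s(u,v) := by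
    intro e; simp [hH]
  have hne : u ≠ v := huv.ne
  have hw1 : ∀ a b, H.Adj a b → w a b + w b a = 1 := by
    intro a b hab
    have := hw a b hab.symm (.cons hab .nil) (by simp [hab.ne])
    simpa using this
  obtain ⟨t, ht⟩ : ∃ t : ZMod 2, ∀ R : H.Walk u v, R.IsPath → wt w R + t = 1 := by
    by_cases hex : ∃ R : H.Walk u v, R.IsPath
    · obtain ⟨R, hR⟩ := hex
      refine ⟨1 - wt w R, fun R' hR' => ?_⟩
      rw [key hle w hT hw huv hnot R.length u .nil R' R le_rfl (by simpa using hR')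
        (by simpa using hR)]
      ring
    · exact ⟨0, fun R hR => absurd ⟨R, hR⟩ hex⟩
  let w' : V → V → ZMod 2 := fun a b =>
    if a = v ∧ b = u then t else if a = u ∧ b = v then 1 - t else w a b
  have hvu : w' v u = t := by simp [w']
  have huv' : w' u v = 1 - t := by simp [w', hne]
  have hww : ∀ a b, H.Adj a b → w' a b = w a b := by
    intro a b hab
    have h1 : ¬ (a = v ∧ b = u) := by rintro ⟨rfl, rfl⟩; exact hnot hab.symm
    have h2 : ¬ (a = u ∧ b = v) := by rintro ⟨rfl, rfl⟩; exact hnot hab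
    simp [w', h1, h2]
  have ht2 : ∀ R : H.Walk v u, R.IsPath → wt w R + (1 - t) = 1 := by
    intro R hR
    have h1 := ht R.reverse hR.reverse
    have h2 := wt_reverse w hw1 R
    have h3 : Odd R.length := by
      have := hO v u huv (R.mapLe hle) (hR.mapLe hle)
      rwa [Walk.length_mapLe] at this
    rw [← ZMod.natCast_eq_one_iff_odd] at h3
    rw [h3] at h2
    linear_combination h2 - h1
  -- both versions for walks of G avoiding the edge
  have c1 : ∀ R : G.Walk u v, R.IsPath → s(u,v) ∉ R.edges → wt w' R + w' v u = 1 := by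
    intro R hR he
    have hp : ∀ e ∈ R.edges, e ∈ H.edgeSet := fun e hh =>
      (hHe e).2 ⟨R.edges_subset_edgeSet hh, fun h => he (h ▸ hh)⟩
    rw [← wt_transfer w' w R hp hww, hvu]
    exact ht _ (hR.transfer hp)
  have c2 : ∀ R : G.Walk v u, R.IsPath → s(u,v) ∉ R.edges → wt w' R + w' u v = 1 := by
    intro R hR he
    have hp : ∀ e ∈ R.edges, e ∈ H.edgeSet := fun e hh =>
      (hHe e).2 ⟨R.edges_subset_edgeSet hh, fun h => he (h ▸ hh)⟩
    rw [← wt_transfer w' w R hp hww, huv']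
    exact ht2 _ (hR.transfer hp)
  refine ⟨w', ?_⟩
  intro x y hyx Q hQ
  by_cases hxy : s(x,y) = s(u,v)
  · by_cases he : s(u,v) ∈ Q.edges
    · rw [← hxy] at he
      have hl := hQ.length_eq_one_of_mem_edges he
      have hQ' : wt w' Q = w' x y := by
        cases Q with
        | nil => simp at hl
        | cons h q =>
          cases q with
          | nil => simp
          | cons h' q => simp at hl
      rw [hQ']
      rw [Sym2.eq_iff] at hxy
      rcases hxy with ⟨rfl, rfl⟩ | ⟨rfl, rfl⟩
      · rw [hvu, huv']; ring
      · rw [hvu, huv']; ring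
    · rw [Sym2.eq_iff] at hxy
      rcases hxy with ⟨rfl, rfl⟩ | ⟨rfl, rfl⟩
      · exact c1 Q hQ he
      · exact c2 Q hQ he
  · have hyxH : H.Adj y x := by
      rw [← mem_edgeSet, hHe]
      exact ⟨hyx, fun h => hxy (by rw [Sym2.eq_swap]; exact h)⟩
    by_cases he : s(u,v) ∈ Q.edges
    · obtain ⟨a, b, h, A, B, rfl, hab⟩ := split_dart Q he
      have hab' : s(a,b) = s(u,v) := by rw [Sym2.eq_iff]; exact hab
      obtain ⟨pA, pB, dAB⟩ := (isPath_append _ _).1 hQ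
      rw [Walk.cons_isPath_iff] at pB
      have dd : ∀ z ∈ A.support, z ∈ B.support → False := by
        intro z hz hz'
        have := dAB z hz (by simp [hz'])
        subst this; exact pB.2 hz'
      have pR : (B.append (.cons hyx A)).IsPath := by
        rw [isPath_append, Walk.cons_isPath_iff]
        refine ⟨pB.1, ⟨pA, fun hh => dd y hh (by simp)⟩, ?_⟩
        intro z hz hz'
        rw [Walk.support_cons, List.mem_cons] at hz'
        rcases hz' with hz' | hz'
        · exact hz'
        · exact (dd z hz' hz).elim
      have eR : s(u,v) ∉ (B.append (.cons hyx A)).edges := by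
        rw [← hab']
        simp only [Walk.edges_append, Walk.edges_cons, List.mem_append, List.mem_cons, not_or]
        refine ⟨fun hh => pB.2 (B.fst_mem_support_of_mem_edges hh), ?_,
          fun hh => dd b (A.snd_mem_support_of_mem_edges hh) (by simp)⟩
        rw [hab']
        exact fun h => hxy (by rw [h]; exact Sym2.eq_swap)
      have e1 : wt w' (B.append (.cons hyx A)) + w' a b = 1 := by
        rcases hab with ⟨rfl, rfl⟩ | ⟨rfl, rfl⟩
        · exact c2 _ pR eR
        · exact c1 _ pR eR
      simp only [wt_append, wt_cons] at e1 ⊢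
      linear_combination e1
    · have hp : ∀ e ∈ Q.edges, e ∈ H.edgeSet := fun e hh =>
        (hHe e).2 ⟨Q.edges_subset_edgeSet hh, fun h => he (h ▸ hh)⟩
      rw [← wt_transfer w' w Q hp hww, hww y x hyxH]
      exact hw x y hyxH _ (hQ.transfer hp)

lemma exists_good [Finite V] (G : SimpleGraph V) (hT : ¬ Theta G) (hO : OddP G) :
    ∃ w, Good G w := by
  classical
  induction G using WellFoundedLT.induction with
  | ind G ih =>
    by_cases hex : ∃ u v, G.Adj u v
    · obtain ⟨u, v, huv⟩ := hex
      have hle : G.deleteEdges {s(u,v)} ≤ G := G.deleteEdges_le _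
      have hlt : G.deleteEdges {s(u,v)} < G := by
        refine lt_of_le_of_ne hle fun h => ?_
        have : (G.deleteEdges {s(u,v)}).Adj u v := by rw [h]; exact huv
        simp at this
      obtain ⟨w, hw⟩ := ih _ hlt (fun h => hT (h.mono hle)) (hO.mono hle)
      exact step hT hO huv w hw
    · push Not at hex
      exact ⟨fun _ _ => 0, fun x y h => absurd h (hex y x)⟩

lemma walk_of_fun {G : SimpleGraph V} (w : V → V → ZMod 2) (n : ℕ) (c : ℕ → V)
    (hc : ∀ i < n, G.Adj (c i) (c (i+1))) :
    ∃ p : G.Walk (c 0) (c n), (∀ x ∈ p.support, ∃ i ≤ n, c i = x) ∧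
      ((∀ i ≤ n, ∀ j ≤ n, c i = c j → i = j) → p.IsPath) ∧
      wt w p = ∑ i ∈ Finset.range n, w (c i) (c (i+1)) := by
  induction n with
  | zero => exact ⟨.nil, by simp, by simp, by simp⟩
  | succ n ih =>
    obtain ⟨p, hs, hp, hw⟩ := ih (fun i hi => hc i (by omega))
    refine ⟨p.append (.cons (hc n (by omega)) .nil), ?_, ?_, ?_⟩
    · intro x hx
      simp only [Walk.mem_support_append_iff, Walk.support_cons, Walk.support_nil,
        List.mem_cons, List.not_mem_nil, or_false] at hx
      rcases hx with hx | rfl | rfl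
      · obtain ⟨i, hi, h⟩ := hs x hx
        exact ⟨i, by omega, h⟩
      · exact ⟨n, by omega, rfl⟩
      · exact ⟨n+1, le_rfl, rfl⟩
    · intro hinj
      rw [isPath_append]
      refine ⟨hp fun i hi j hj => hinj i (by omega) j (by omega), ?_, ?_⟩
      · simp [(hc n (by omega)).ne]
      · intro x hx hx'
        simp only [Walk.support_cons, Walk.support_nil,
          List.mem_cons, List.not_mem_nil, or_false] at hx'
        rcases hx' with h | h
        · exact h
        · obtain ⟨i, hi, h'⟩ := hs x hx
          have := hinj i (by omega) (n+1) le_rfl (h'.trans h)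
          omega
    · simp [hw, Finset.sum_range_succ]

lemma noneven_of_good {G : SimpleGraph V} (w : V → V → ZMod 2) (hw : Good G w) :
    IsNoneven (fun u v => G.Adj u v) := by
  refine ⟨w, ?_⟩
  rintro m c ⟨hinj, hadj⟩
  let d : ℕ → V := fun i => c (Fin.ofNat (m+1) i)
  have hd : ∀ i : ℕ, i < m → (Fin.ofNat (m+1) i) + 1 = Fin.ofNat (m+1) (i+1) := by
    intro i hi
    ext; simp [Fin.val_add, Fin.ofNat]
  have hlast : (Fin.ofNat (m+1) m) + 1 = Fin.ofNat (m+1) 0 := by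
    ext; simp [Fin.val_add, Fin.ofNat]
  obtain ⟨p, -, hp, hs⟩ := walk_of_fun w m d (G := G) (by
    intro i hi
    have := hadj (Fin.ofNat (m+1) i)
    rwa [hd i hi] at this)
  have pp := hp (by
    intro i hi j hj h
    have := congrArg Fin.val (hinj h)
    simpa [Fin.ofNat, Nat.mod_eq_of_lt (show i < m+1 by omega),
      Nat.mod_eq_of_lt (show j < m+1 by omega)] using this)
  have hcl := hadj (Fin.ofNat (m+1) m)
  rw [hlast] at hcl
  have key := hw (d 0) (d m) hcl p pp
  have e : ∀ i : Fin (m+1), w (c i) (c (i+1)) =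
      (fun k : ℕ => w (d k) (c (Fin.ofNat (m+1) k + 1))) i := by
    intro i
    have : Fin.ofNat (m+1) (i : ℕ) = i := by ext; simp [Fin.ofNat, Nat.mod_eq_of_lt i.2]
    simp only [d, this]
  rw [Finset.sum_congr rfl (fun i _ => e i), Fin.sum_univ_eq_sum_range
    (fun k : ℕ => w (d k) (c (Fin.ofNat (m+1) k + 1))) (m+1), Finset.sum_range_succ, hlast]
  rw [hs] at key
  rw [← key]
  congr 1
  refine Finset.sum_congr rfl fun i hi => ?_
  rw [hd i (Finset.mem_range.1 hi)]

/-- An odd cycle with an ear gives a theta. -/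
lemma theta_of_ear {G : SimpleGraph V} {x y : V} (c : G.Walk x x) (hc : c.IsCycle)
    (hodd : Odd c.length) (hxy : x ≠ y) (hy : y ∈ c.support) (S : G.Walk x y) (hS : S.IsPath)
    (hd : ∀ z ∈ S.support, z ∈ c.support → z = x ∨ z = y) (he : ∃ e ∈ S.edges, e ∉ c.edges) :
    Theta G := by
  obtain ⟨T, D, rfl⟩ := Walk.mem_support_iff_exists_append.1 hy
  obtain ⟨e, he1, he2⟩ := he
  have hTn : ¬ T.Nil := Walk.not_nil_of_ne hxy
  have hDn : ¬ D.Nil := Walk.not_nil_of_ne hxy.symm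
  have pT := hc.isPath_of_append_left hDn
  have pD := hc.isPath_of_append_right hTn
  rw [Walk.edges_append, List.mem_append, not_or] at he2
  rw [Walk.length_append] at hodd
  simp only [Walk.mem_support_append_iff] at hd
  refine ⟨x, y, hxy, T, D.reverse, S, pT, pD.reverse, hS, ?_, ?_, ?_, ?_, ?_, ?_, ?_⟩
  · intro h
    have := congrArg Walk.length h
    rw [Walk.length_reverse] at this
    rw [this] at hodd
    exact (Nat.not_odd_iff_even.2 ⟨_, rfl⟩) hodd
  · rintro rfl; exact he2.1 he1
  · rintro rfl; simp at he1; exact he2.2 he1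
  · intro z hz hz'
    rw [Walk.support_reverse, List.mem_reverse] at hz'
    by_contra hcon
    push Not at hcon
    have hn := hc.support_nodup
    rw [Walk.tail_support_append, List.nodup_append] at hn
    refine hn.2.2 z ?_ z ?_ rfl
    · rw [Walk.mem_support_iff] at hz; tauto
    · rw [Walk.mem_support_iff] at hz'; tauto
  · intro z hz hz'; exact hd z hz' (Or.inl hz)
  · intro z hz hz'
    rw [Walk.support_reverse, List.mem_reverse] at hz
    exact hd z hz' (Or.inr hz)
  · rw [Walk.length_reverse, ← or_assoc]
    left
    by_contra hcon
    push Not at hcon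
    rw [Nat.not_even_iff_odd, Nat.not_even_iff_odd] at hcon
    exact (Nat.not_odd_iff_even.2 (hcon.1.add_odd hcon.2)) hodd

lemma oddP [Fintype V] (G : SimpleGraph V) [DecidableRel G.Adj] (h2 : GraphTwoConnected G)
    (hnc : ¬ (Odd (Fintype.card V) ∧ ∀ v, G.degree v = 2)) (hT : ¬ Theta G) : OddP G := by
  classical
  intro x0 y0 hadj Q hQ
  by_contra hev
  rw [Nat.not_odd_iff_even] at hev
  obtain ⟨c, hc, hodd⟩ : ∃ c : G.Walk y0 y0, c.IsCycle ∧ Odd c.length := by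
    refine ⟨.cons hadj Q, ?_, by simpa using hev.add_one⟩
    rw [Walk.cons_isCycle_iff]
    refine ⟨hQ, fun he => ?_⟩
    rw [Sym2.eq_swap] at he
    rw [hQ.length_eq_one_of_mem_edges he] at hev
    exact absurd hev (by decide)
  have hall : ∀ x ∈ c.support, ∀ b, G.Adj x b → s(x,b) ∈ c.edges := by
    intro x hx b hxb
    by_contra hne
    apply hT
    let c' := c.rotate x hx
    have hc' : c'.IsCycle := hc.rotate hx
    have hlen : c'.length = c.length := Walk.length_rotate _ _ _
    have hsup : ∀ z, z ∈ c'.support ↔ z ∈ c.support := fun z => Walk.mem_support_rotate_iff _ _ _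
    have hed : ∀ e, e ∈ c'.edges ↔ e ∈ c.edges := fun e => (c.rotate_edges x hx).mem_iff
    -- another vertex of the cycle
    obtain ⟨t, htx, ht⟩ : ∃ t, t ≠ x ∧ t ∈ c'.support :=
      ⟨c'.snd, (c'.adj_snd hc'.not_nil).ne', c'.getVert_mem_support 1⟩
    obtain ⟨p⟩ := (h2.2 x).preconnected ⟨b, hxb.ne'⟩ ⟨t, htx⟩
    let q : G.Walk b t := p.map (Embedding.induce _).toHom
    have hxq : x ∉ q.support := by
      intro h
      have h : x ∈ (p.map (Embedding.induce (G := G) {u | u ≠ x}).toHom).support := h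
      rw [Walk.support_map] at h
      replace h := List.mem_map.1 h
      obtain ⟨a, -, ha⟩ := h
      exact a.2 ha
    have hxq' : x ∉ q.bypass.support := fun h => hxq (q.support_bypass_subset_support h)
    obtain ⟨y, S, r, hqe, hy, hS⟩ := first_hit (fun z => z ∈ c'.support) q.bypass ht
    have pq := q.bypass_isPath
    rw [hqe, isPath_append] at pq
    have hxS : x ∉ S.support := by
      intro h; apply hxq'; rw [hqe, Walk.mem_support_append_iff]; exact Or.inl h
    refine theta_of_ear c' hc' (hlen ▸ hodd) (y := y) ?_ hy (.cons hxb S) ?_ ?_ ?_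
    · rintro rfl; exact hxS (by simp)
    · rw [Walk.cons_isPath_iff]; exact ⟨pq.1, hxS⟩
    · intro z hz hz'
      rw [Walk.support_cons, List.mem_cons] at hz
      rcases hz with h | h
      · exact Or.inl h
      · exact Or.inr (hS z h hz')
    · exact ⟨s(x,b), by simp, by rw [hed]; exact hne⟩
  have hsupp : ∀ z, z ∈ c.support := by
    intro z
    obtain ⟨p⟩ := h2.1.preconnected y0 z
    have gen : ∀ {a b : V} (p : G.Walk a b), a ∈ c.support → b ∈ c.support := by
      intro a b p
      induction p with
      | nil => exact id
      | cons h p ih => exact fun ha => ih (c.snd_mem_support_of_mem_edges (hall _ ha _ h))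
    exact gen p (by simp)
  apply hnc
  constructor
  · have hn := hc.support_nodup
    have hm : ∀ z, z ∈ c.support.tail := by
      intro z
      have := hsupp z
      rw [Walk.mem_support_iff] at this
      rcases this with rfl | h
      · exact Walk.end_mem_tail_support hc.not_nil
      · exact h
    have h1 : c.support.tail.toFinset = Finset.univ := by ext z; simp [hm z]
    rw [← Finset.card_univ, ← h1, List.toFinset_card_of_nodup hn]
    simpa using hodd
  · intro v
    have h := hc.ncard_neighborSet_toSubgraph_eq_two (hsupp v)
    have h' : c.toSubgraph.neighborSet v = G.neighborSet v := by
      ext b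
      rw [Subgraph.mem_neighborSet, mem_neighborSet, Walk.adj_toSubgraph_iff_mem_edges]
      exact ⟨fun h => c.adj_of_mem_edges h, fun h => hall v (hsupp v) b h⟩
    rw [h', Set.ncard_eq_toFinset_card'] at h
    exact h

end ST4

/-- a 2-connected graph that is not an odd cycle and has no pair of
vertices joined by three internally disjoint paths, one of even length, has a
noneven symmetric digraph G*. -/
theorem stmt4 {V : Type} [Fintype V] (G : SimpleGraph V) [DecidableRel G.Adj]
    (h2 : GraphTwoConnected G)
    (hnotcycle : ¬ (Odd (Fintype.card V) ∧ ∀ v, G.degree v = 2))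
    (hnopaths : ¬ ∃ (u v : V) (_ : u ≠ v) (p₁ p₂ p₃ : G.Walk u v),
        p₁.IsPath ∧ p₂.IsPath ∧ p₃.IsPath ∧ p₁ ≠ p₂ ∧ p₁ ≠ p₃ ∧ p₂ ≠ p₃ ∧
        (∀ x, x ∈ p₁.support → x ∈ p₂.support → x = u ∨ x = v) ∧
        (∀ x, x ∈ p₁.support → x ∈ p₃.support → x = u ∨ x = v) ∧
        (∀ x, x ∈ p₂.support → x ∈ p₃.support → x = u ∨ x = v) ∧
        (Even p₁.length ∨ Even p₂.length ∨ Even p₃.length)) :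
    IsNoneven (fun u v => G.Adj u v) := by
  have hT : ¬ ST4.Theta G := hnopaths
  obtain ⟨w, hw⟩ := ST4.exists_good G hT (ST4.oddP G h2 hnotcycle hT)
  exact ST4.noneven_of_good w hw
end

section
/- Let H be a negative-diagonal sign-nonsingular pattern that allows symplectic pairs. Then H is maximal (no zero entry of H can be changed to ±1 while preserving sign-nonsingularity) if and only if H is irreducible (its digraph is strongly connected). -/
open Matrix

lemma aux_sign_zero_iff {x y : ℝ} (h : Real.sign x = Real.sign y) : x = 0 ↔ y = 0 := by
  rw [← Real.sign_eq_zero_iff, h, Real.sign_eq_zero_iff]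

lemma aux_sign_smul {c : ℝ} (hc : 0 < c) (x : ℝ) : Real.sign (c * x) = Real.sign x := by
  rcases lt_trichotomy x 0 with h | h | h
  · rw [Real.sign_of_neg h, Real.sign_of_neg (mul_neg_of_pos_of_neg hc h)]
  · simp [h]
  · rw [Real.sign_of_pos h, Real.sign_of_pos (mul_pos hc h)]

lemma aux_sign_comb {x y a b : ℝ} (h : Real.sign x = Real.sign y) (ha : 0 ≤ a) (hb : 0 ≤ b)
    (hab : a + b = 1) : Real.sign (a * x + b * y) = Real.sign y := by
  rcases lt_trichotomy y 0 with hy | hy | hy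
  · have hx : x < 0 := by
      rcases lt_trichotomy x 0 with hx | hx | hx
      · exact hx
      · rw [hx, Real.sign_of_neg hy] at h; norm_num at h
      · rw [Real.sign_of_pos hx, Real.sign_of_neg hy] at h; norm_num at h
    rw [Real.sign_of_neg hy]
    apply Real.sign_of_neg
    rcases ha.eq_or_lt with h0 | h0
    · have : b = 1 := by linarith
      subst h0; subst this; linarith
    · nlinarith [mul_neg_of_pos_of_neg h0 hx]
  · have hx : x = 0 := (aux_sign_zero_iff h).2 hy
    simp [hx, hy]
  · have hx : 0 < x := by
      rcases lt_trichotomy x 0 with hx | hx | hx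
      · rw [Real.sign_of_neg hx, Real.sign_of_pos hy] at h; norm_num at h
      · rw [hx, Real.sign_of_pos hy] at h; norm_num at h
      · exact hx
    rw [Real.sign_of_pos hy]
    apply Real.sign_of_pos
    rcases ha.eq_or_lt with h0 | h0
    · have : b = 1 := by linarith
      subst h0; subst this; linarith
    · nlinarith [mul_pos h0 hx]

lemma aux_det_block {n : ℕ} (p : Fin n → Prop) (M N : Matrix (Fin n) (Fin n) ℝ)
    (hM : ∀ i, p i → ∀ j, ¬ p j → M i j = 0) (hN : ∀ i, p i → ∀ j, ¬ p j → N i j = 0)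
    (h : ∀ i j, (p i ↔ p j) → M i j = N i j) : M.det = N.det := by
  classical
  rw [Matrix.twoBlockTriangular_det' M p hM, Matrix.twoBlockTriangular_det' N p hN]
  congr 2
  · ext i j
    exact h i j (by simp [i.2, j.2])
  · ext i j
    exact h i j (by have := i.2; have := j.2; tauto)

lemma aux_forward {n : ℕ} (H : Matrix (Fin n) (Fin n) ℝ)
    (hsns : IsSignNonsingular H)
    (hsp : AllowsSymplecticPairs H)
    (hmax : ∀ i j, H i j = 0 → ∀ ε : ℝ, (ε = 1 ∨ ε = -1) →
        ¬ IsSignNonsingular (Matrix.of fun a b => if a = i ∧ b = j then ε else H a b)) :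
      StronglyConnected (fun i j : Fin n => i ≠ j ∧ H i j ≠ 0) := by
  classical
  intro u v
  by_contra huv
  let p : Fin n → Prop := fun i =>
    Relation.ReflTransGen (fun i j : Fin n => i ≠ j ∧ H i j ≠ 0) u i
  have pu : p u := Relation.ReflTransGen.refl
  have pv : ¬ p v := huv
  have hH : ∀ i, p i → ∀ j, ¬ p j → H i j = 0 := by
    intro i hi j hj
    by_contra hne
    refine hj (hi.tail ⟨?_, hne⟩)
    rintro rfl
    exact hj hi
  have hQ : ∀ A : Matrix (Fin n) (Fin n) ℝ, HasSignPattern A H →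
      ∀ i, p i → ∀ j, ¬ p j → A i j = 0 := by
    intro A hA i hi j hj
    have := hA i j
    rw [hH i hi j hj, Real.sign_eq_zero_iff] at this
    exact this
  obtain ⟨A, D, hA, hD, hAD⟩ := hsp
  have hvu : H v u = 0 := by
    rw [← hD v u, Real.sign_eq_zero_iff]
    let A0 : Matrix (Fin n) (Fin n) ℝ := Matrix.of fun i j => if ¬ p i ∧ p j then 0 else A i j
    have hdet : A0.det ≠ 0 := by
      rw [aux_det_block p A0 A _ (hQ A hA) _]
      · exact hsns A hA
      · intro i hi j hj
        simp [A0, hi, hQ A hA i hi j hj]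
      · intro i j hij
        simp only [A0, Matrix.of_apply]
        rw [if_neg]
        tauto
    let w : Fin n → ℝ := fun i => if p i then 0 else D i u
    have hw : w ᵥ* A0 = 0 := by
      ext k
      simp only [Matrix.vecMul, dotProduct, Pi.zero_apply]
      by_cases hk : p k
      · apply Finset.sum_eq_zero
        intro i _
        by_cases hi : p i <;> simp [w, A0, hi, hk]
      · have h1 := congrFun (congrFun hAD k) u
        rw [Matrix.mul_apply, Matrix.one_apply_ne (by rintro rfl; exact hk pu)] at h1
        rw [← h1]
        apply Finset.sum_congr rfl
        intro i _
        by_cases hi : p i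
        · simp [w, hi, hQ A hA i hi k hk]
        · simp [w, A0, hi, hk, mul_comm]
    have := Matrix.eq_zero_of_vecMul_eq_zero hdet hw
    have := congrFun this v
    simpa [w, pv] using this
  apply hmax v u hvu 1 (Or.inl rfl)
  intro B hB
  have hBz : ∀ i, p i → ∀ j, ¬ p j → B i j = 0 := by
    intro i hi j hj
    have := hB i j
    rw [Matrix.of_apply, if_neg (by rintro ⟨rfl, -⟩; exact pv hi), hH i hi j hj,
      Real.sign_eq_zero_iff] at this
    exact this
  let C : Matrix (Fin n) (Fin n) ℝ := Matrix.of fun i j => if i = v ∧ j = u then 0 else B i j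
  have hC : HasSignPattern C H := by
    intro i j
    simp only [C, Matrix.of_apply]
    split_ifs with h
    · rw [h.1, h.2, hvu]; simp
    · rw [hB i j, Matrix.of_apply, if_neg h]
  rw [aux_det_block p B C hBz (hQ C hC) _]
  · exact hsns C hC
  · intro i j hij
    simp only [C, Matrix.of_apply]
    rw [if_neg]
    rintro ⟨rfl, rfl⟩
    exact pv (hij.2 pu)

def AuxDom {n : ℕ} (B : Matrix (Fin n) (Fin n) ℝ) : Prop :=
  ∀ k, ∑ j ∈ Finset.univ.erase k, ‖B k j‖ < ‖B k k‖

lemma aux_dom_vec {n : ℕ} (B : Matrix (Fin n) (Fin n) ℝ) (hB : AuxDom B) (l : Fin n)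
    (y : Fin n → ℝ) (hl : y l = 0) (hy : ∀ k, k ≠ l → (y ᵥ* B) k = 0) : y = 0 := by
  classical
  let C : Matrix (Fin n) (Fin n) ℝ := Matrix.of fun i j => if i ≠ l ∧ j = l then 0 else B i j
  have hC : C.det ≠ 0 := by
    apply det_ne_zero_of_sum_row_lt_diag
    intro k
    have h2 : C k k = B k k := by
      simp only [C, Matrix.of_apply]
      rw [if_neg]
      rintro ⟨h, h'⟩
      exact h h'
    rw [h2]
    refine lt_of_le_of_lt (Finset.sum_le_sum ?_) (hB k)
    intro j _
    simp only [C, Matrix.of_apply]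
    split_ifs <;> simp
  apply Matrix.eq_zero_of_vecMul_eq_zero hC
  ext k
  by_cases hk : k = l
  · simp only [Matrix.vecMul, dotProduct, Pi.zero_apply]
    apply Finset.sum_eq_zero
    intro i _
    by_cases hi : i = l
    · rw [hi, hl, zero_mul]
    · simp [C, hi, hk]
  · rw [Pi.zero_apply, ← hy k hk]
    simp only [Matrix.vecMul, dotProduct]
    apply Finset.sum_congr rfl
    intro i _
    simp [C, hk]

lemma aux_path {n : ℕ} (H : Matrix (Fin n) (Fin n) ℝ) (hp : IsSignPattern H)
    (hd : NegativeDiagonal H) (j i : Fin n)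
    (h : Relation.ReflTransGen (fun i j : Fin n => i ≠ j ∧ H i j ≠ 0) j i) :
    ∃ B : Matrix (Fin n) (Fin n) ℝ, HasSignPattern B H ∧ AuxDom B ∧
      ∃ x : Fin n → ℝ, x ᵥ* B = Pi.single j 1 ∧ x i ≠ 0 := by
  classical
  have hrow : ∀ B : Matrix (Fin n) (Fin n) ℝ, AuxDom B →
      ∃ x : Fin n → ℝ, x ᵥ* B = Pi.single j 1 := by
    intro B hB
    refine ⟨Pi.single j 1 ᵥ* B⁻¹, ?_⟩
    rw [Matrix.vecMul_vecMul, Matrix.nonsing_inv_mul, Matrix.vecMul_one]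
    exact (det_ne_zero_of_sum_row_lt_diag hB).isUnit
  induction h with
  | refl =>
    let B : Matrix (Fin n) (Fin n) ℝ :=
      Matrix.of fun a b => (if a = b then 1 else (1 / ((n : ℝ) + 1))) * H a b
    have hpos : (0 : ℝ) < 1 / ((n : ℝ) + 1) := by positivity
    have hBd : AuxDom B := by
      intro k
      have h1 : ‖B k k‖ = 1 := by simp [B, hd k]
      rw [h1]
      calc ∑ j ∈ Finset.univ.erase k, ‖B k j‖
          ≤ ∑ j ∈ Finset.univ.erase k, 1 / ((n : ℝ) + 1) := by
            apply Finset.sum_le_sum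
            intro m hm
            have hkm : k ≠ m := fun h => (Finset.ne_of_mem_erase hm) h.symm
            simp only [B, Matrix.of_apply, if_neg hkm, norm_mul, Real.norm_eq_abs, abs_of_pos hpos]
            have : |H k m| ≤ 1 := by rcases hp k m with h | h | h <;> simp [h]
            nlinarith
        _ ≤ ∑ j : Fin n, 1 / ((n : ℝ) + 1) := by
            apply Finset.sum_le_sum_of_subset_of_nonneg (Finset.erase_subset _ _)
            intros; positivity
        _ < 1 := by
            simp only [Finset.sum_const, Finset.card_univ, Fintype.card_fin, nsmul_eq_mul]
            rw [mul_one_div, div_lt_one (by positivity)]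
            linarith
    refine ⟨B, ?_, hBd, ?_⟩
    · intro a b
      simp only [B, Matrix.of_apply]
      rw [aux_sign_smul (by split_ifs <;> positivity)]
      rcases hp a b with h | h | h <;> rw [h]
      · exact Real.sign_of_neg (by norm_num)
      · exact Real.sign_zero
      · exact Real.sign_of_pos (by norm_num)
    · obtain ⟨x, hx⟩ := hrow B hBd
      refine ⟨x, hx, fun h0 => ?_⟩
      have := aux_dom_vec B hBd j x h0 (by
        intro k hk; rw [hx]; simp [hk])
      rw [this, Matrix.zero_vecMul] at hx
      have := congrFun hx j
      simp at this
  | @tail k l _ hkl ih =>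
    obtain ⟨B, hB, hBd, x, hx, hxk⟩ := ih
    by_cases hxl : x l = 0
    swap
    · exact ⟨B, hB, hBd, x, hx, hxl⟩
    let B' : Matrix (Fin n) (Fin n) ℝ :=
      Matrix.of fun a b => (if a = k ∧ b = l then (1 / 2) else 1) * B a b
    have hBd' : AuxDom B' := by
      intro a
      have h2 : B' a a = B a a := by
        simp only [B', Matrix.of_apply]
        rw [if_neg, one_mul]
        rintro ⟨rfl, h⟩
        exact hkl.1 h
      rw [h2]
      refine lt_of_le_of_lt (Finset.sum_le_sum ?_) (hBd a)
      intro b _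
      simp only [B', Matrix.of_apply, norm_mul, Real.norm_eq_abs]
      have := abs_nonneg (B a b)
      split_ifs
      · rw [abs_of_pos (by norm_num)]; linarith
      · simp
    obtain ⟨x', hx'⟩ := hrow B' hBd'
    refine ⟨B', ?_, hBd', x', hx', fun h0 => ?_⟩
    · intro a b
      simp only [B', Matrix.of_apply]
      rw [aux_sign_smul (by split_ifs <;> norm_num), hB a b]
    · have hBkl : B k l ≠ 0 := by
        intro h
        have := hB k l
        rw [h, Real.sign_zero] at this
        exact hkl.2 this.symm
      have hxB' : ∀ m, (x ᵥ* B') m = (x ᵥ* B) m - if m = l then x k * (B k l / 2) else 0 := by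
        intro m
        simp only [Matrix.vecMul, dotProduct]
        by_cases hm : m = l
        · subst hm
          rw [if_pos rfl, ← Finset.add_sum_erase _ _ (Finset.mem_univ k),
            ← Finset.add_sum_erase _ (fun i => x i * B i m) (Finset.mem_univ k)]
          have : ∑ a ∈ Finset.univ.erase k, x a * B' a m
              = ∑ a ∈ Finset.univ.erase k, x a * B a m := by
            apply Finset.sum_congr rfl
            intro a ha
            simp [B', Finset.ne_of_mem_erase ha]
          rw [this]
          simp [B']
          ring
        · rw [if_neg hm, sub_zero]
          apply Finset.sum_congr rfl
          intro a _
          simp [B', hm]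
      have hy := aux_dom_vec B' hBd' l (x' - x) (by simp [h0, hxl]) (by
        intro m hm
        rw [Matrix.sub_vecMul, Pi.sub_apply, hxB', hx', hx, if_neg hm]
        simp)
      have hxx : x' = x := sub_eq_zero.1 hy
      have := hxB' l
      rw [← hxx, hx', hxx, hx, if_pos rfl] at this
      have h3 : x k * (B k l / 2) = 0 := by linarith
      have : B k l / 2 ≠ 0 := by simpa using hBkl
      exact (mul_ne_zero hxk this) h3

lemma aux_multi {n : ℕ} (H : Matrix (Fin n) (Fin n) ℝ) (i : Fin n) (e : Fin n → ℝ) (s : ℝ)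
    (hs : s ≠ 0) (A B : Matrix (Fin n) (Fin n) ℝ) (hA : HasSignPattern A H)
    (hB : HasSignPattern B H)
    (hf : ∀ M, HasSignPattern M H → 0 ≤ s * (M.updateRow i e).det)
    (h0 : (A.updateRow i e).det = 0) : (B.updateRow i e).det = 0 := by
  classical
  have key : ∀ S : Finset (Fin n × Fin n),
      ((Matrix.of fun a b => if (a, b) ∈ S then B a b else A a b).updateRow i e).det = 0 := by
    intro S
    induction S using Finset.induction_on with
    | empty =>
      convert h0
      ext a b
      simp
    | @insert q S hq ih =>
      obtain ⟨k, l⟩ := q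
      let M : ℝ → Matrix (Fin n) (Fin n) ℝ := fun t => Matrix.of fun a b =>
        if a = k ∧ b = l then t else if (a, b) ∈ S then B a b else A a b
      have e1 : (Matrix.of fun a b => if (a, b) ∈ S then B a b else A a b) = M (A k l) := by
        ext a b
        simp only [M, Matrix.of_apply]
        by_cases h : a = k ∧ b = l
        · rw [if_pos h, h.1, h.2, if_neg hq]
        · rw [if_neg h]
      have e2 : (Matrix.of fun a b => if (a, b) ∈ insert (k, l) S then B a b else A a b)
          = M (B k l) := by
        ext a b
        simp only [M, Matrix.of_apply]
        by_cases h : a = k ∧ b = l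
        · rw [if_pos h, h.1, h.2, if_pos (Finset.mem_insert_self _ _)]
        · rw [if_neg h]
          have : (a, b) ≠ (k, l) := by simpa using h
          simp [Finset.mem_insert, h]
      rw [e1] at ih
      rw [e2]
      obtain ⟨α, β, hαβ⟩ : ∃ α β : ℝ, ∀ t, ((M t).updateRow i e).det = α + t * β := by
        by_cases hki : k = i
        · refine ⟨((M 0).updateRow i e).det, 0, fun t => ?_⟩
          rw [mul_zero, add_zero]
          congr 1
          ext a b
          by_cases ha : a = i
          · subst ha; simp
          · have : a ≠ k := by rw [hki]; exact ha
            simp [Matrix.updateRow_ne ha, M, this]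
        · refine ⟨((M 0).updateRow i e).det,
            (((M 0).updateRow i e).updateRow k (Pi.single l 1)).det, fun t => ?_⟩
          rw [← Matrix.det_updateRow_smul]
          have e3 : ((M 0).updateRow i e) = ((M 0).updateRow i e).updateRow k ((M 0) k) := by
            ext a b
            by_cases ha : a = k
            · subst ha; simp [Matrix.updateRow_ne hki]
            · simp [Matrix.updateRow_ne ha]
          conv_rhs => enter [1]; rw [e3]
          rw [← Matrix.det_updateRow_add]
          congr 1
          ext a b
          by_cases ha : a = k
          · subst ha
            rw [Matrix.updateRow_ne hki, Matrix.updateRow_self]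
            by_cases hb : b = l
            · subst hb; simp [M]
            · simp [M, hb]
          · rw [Matrix.updateRow_ne ha]
            by_cases hi : a = i
            · subst hi; simp
            · simp [Matrix.updateRow_ne hi, M, ha]
      have hM : ∀ c : ℝ, 0 < c → HasSignPattern (M (c * A k l)) H := by
        intro c hc a b
        simp only [M, Matrix.of_apply]
        split_ifs with h h'
        · rw [aux_sign_smul hc, h.1, h.2, hA]
        · exact hB a b
        · exact hA a b
      have i1 := hf _ (hM (1 / 2) (by norm_num))
      have i2 := hf _ (hM (3 / 2) (by norm_num))
      rw [hαβ] at ih i1 i2 ⊢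
      have hα : α = - (A k l * β) := by linarith
      have hz : s * (A k l * β) = 0 := by
        rw [hα] at i1 i2
        nlinarith
      have hz' : A k l * β = 0 := (mul_eq_zero.1 hz).resolve_left hs
      rw [hα, hz']
      rcases mul_eq_zero.1 hz' with h | h
      · have : B k l = 0 := (aux_sign_zero_iff ((hA k l).trans (hB k l).symm)).1 h
        simp [this]
      · simp [h]
  have := key Finset.univ
  convert this
  ext a b
  simp

lemma aux_det_sign {n : ℕ} (H : Matrix (Fin n) (Fin n) ℝ) (hsns : IsSignNonsingular H)
    (A B : Matrix (Fin n) (Fin n) ℝ) (hA : HasSignPattern A H) (hB : HasSignPattern B H) :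
    0 < A.det * B.det := by
  have hconv : Convex ℝ {M : Matrix (Fin n) (Fin n) ℝ | HasSignPattern M H} := by
    intro M hM N hN a b ha hb hab k l
    have := aux_sign_comb ((hM k l).trans (hN k l).symm) ha hb hab
    rw [hN k l] at this
    simpa using this
  have hpre := hconv.isPreconnected
  have hc : ContinuousOn (fun M : Matrix (Fin n) (Fin n) ℝ => M.det)
      {M : Matrix (Fin n) (Fin n) ℝ | HasSignPattern M H} :=
    (Continuous.matrix_det continuous_id).continuousOn
  have hAn := hsns A hA
  have hBn := hsns B hB
  rcases hAn.lt_or_gt with h1 | h1 <;> rcases hBn.lt_or_gt with h2 | h2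
  · exact mul_pos_of_neg_of_neg h1 h2
  · obtain ⟨M, hM, hM0⟩ := hpre.intermediate_value hA hB hc ⟨h1.le, h2.le⟩
    exact absurd hM0 (hsns M hM)
  · obtain ⟨M, hM, hM0⟩ := hpre.intermediate_value hB hA hc ⟨h2.le, h1.le⟩
    exact absurd hM0 (hsns M hM)
  · exact mul_pos h1 h2

lemma aux_backward {n : ℕ} (H : Matrix (Fin n) (Fin n) ℝ) (hp : IsSignPattern H)
    (hd : NegativeDiagonal H) (hsns : IsSignNonsingular H)
    (hsp : AllowsSymplecticPairs H)
    (hsc : StronglyConnected (fun i j : Fin n => i ≠ j ∧ H i j ≠ 0)) 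
    (i j : Fin n) (hij : H i j = 0) (ε : ℝ) (hε : ε = 1 ∨ ε = -1) :
    ¬ IsSignNonsingular (Matrix.of fun a b => if a = i ∧ b = j then ε else H a b) := by
  classical
  intro hs'
  obtain ⟨A, D, hA, hD, hAD⟩ := hsp
  obtain ⟨B, hB, hBd, x, hx, hxi⟩ := aux_path H hp hd j i (hsc j i)
  have hε0 : ε ≠ 0 := by rcases hε with h | h <;> rw [h] <;> norm_num
  have hA0 := hsns A hA
  have hmain : ∀ M, HasSignPattern M H →
      0 ≤ (ε * A.det) * (M.updateRow i (Pi.single j 1)).det := by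
    intro M hM
    by_contra hneg
    push Not at hneg
    set f := (M.updateRow i (Pi.single j 1)).det with hfdef
    have hdd := aux_det_sign H hsns A M hA hM
    have hMd := hsns M hM
    have hf0 : f ≠ 0 := by
      intro h; rw [h, mul_zero] at hneg; exact lt_irrefl _ hneg
    let t : ℝ := - M.det / (ε * f)
    have ht : 0 < t := by
      have h4 : M.det * (ε * f) < 0 := by
        by_contra h5
        push Not at h5
        have : 0 ≤ (A.det * M.det) * (M.det * (ε * f)) := mul_nonneg hdd.le h5
        have h6 : (A.det * M.det) * (M.det * (ε * f)) = (M.det)^2 * (ε * A.det * f) := by ring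
        rw [h6] at this
        have h7 : 0 < M.det ^ 2 := by positivity
        nlinarith [mul_pos_of_neg_of_neg hneg (neg_lt_zero.2 h7)]
      have h8 : t = (- (M.det * (ε * f))) / (ε * f) ^ 2 := by
        simp only [t]
        field_simp
      rw [h8]
      have : ε * f ≠ 0 := mul_ne_zero hε0 hf0
      apply div_pos (by linarith) (by positivity)
    have hMij : M i j = 0 := by
      have := hM i j
      rwa [hij, Real.sign_eq_zero_iff] at this
    apply hs' (M.updateRow i (M i + (t * ε) • Pi.single j 1))
    · intro a b
      simp only [Matrix.of_apply]
      by_cases ha : a = i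
      · subst ha
        rw [Matrix.updateRow_self]
        by_cases hb : b = j
        · subst hb
          simp only [Pi.add_apply, Pi.smul_apply, Pi.single_eq_same, hMij, and_self, if_true,
            smul_eq_mul, mul_one, zero_add]
          rw [aux_sign_smul ht]
          rcases hε with h | h <;> rw [h]
          · exact Real.sign_of_pos (by norm_num)
          · exact Real.sign_of_neg (by norm_num)
        · simp [hb, hM a b]
      · rw [Matrix.updateRow_ne ha, if_neg (fun h => ha h.1), hM a b]
    · rw [Matrix.det_updateRow_add, Matrix.det_updateRow_smul, Matrix.updateRow_eq_self,
        ← hfdef]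
      simp only [t]
      field_simp
      ring
  have hfA : (A.updateRow i (Pi.single j 1)).det = 0 := by
    rw [← Matrix.adjugate_apply]
    have hDA : Dᵀ * A = 1 := by
      have := congrArg Matrix.transpose hAD
      simpa using this
    have hADt : A * Dᵀ = 1 := mul_eq_one_comm.1 hDA
    have : A.adjugate = A.det • Dᵀ := by
      calc A.adjugate = A.adjugate * (A * Dᵀ) := by rw [hADt, mul_one]
        _ = A.det • Dᵀ := by
          rw [← mul_assoc, Matrix.adjugate_mul, Matrix.smul_mul, one_mul]
    rw [this]
    have hDij : D i j = 0 := by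
      have := hD i j
      rwa [hij, Real.sign_eq_zero_iff] at this
    simp [hDij]
  have hfB := aux_multi H i _ _ (mul_ne_zero hε0 hA0) A B hA hB hmain hfA
  rw [← Matrix.adjugate_apply] at hfB
  have h1 : (x ᵥ* B) ᵥ* B.adjugate = B.det • x := by
    rw [Matrix.vecMul_vecMul, Matrix.mul_adjugate, Matrix.vecMul_smul, Matrix.vecMul_one]
  rw [hx] at h1
  have h2 := congrFun h1 i
  rw [Matrix.single_one_vecMul] at h2
  simp only [Matrix.row, Pi.smul_apply, smul_eq_mul] at h2
  rw [hfB] at h2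
  exact mul_ne_zero (hsns B hB) hxi h2.symm

/-- for a negative-diagonal sign-nonsingular pattern allowing
symplectic pairs, maximality is equivalent to irreducibility. -/
theorem stmt14 {n : ℕ} (H : Matrix (Fin n) (Fin n) ℝ) (hp : IsSignPattern H)
    (hd : NegativeDiagonal H) (hsns : IsSignNonsingular H)
    (hsp : AllowsSymplecticPairs H) :
    (∀ i j, H i j = 0 → ∀ ε : ℝ, (ε = 1 ∨ ε = -1) →
        ¬ IsSignNonsingular (Matrix.of fun a b => if a = i ∧ b = j then ε else H a b)) ↔
      StronglyConnected (fun i j : Fin n => i ≠ j ∧ H i j ≠ 0) := by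
  constructor
  · exact aux_forward H hsns hsp
  · intro hsc i j hij ε hε
    exact aux_backward H hp hd hsns hsp hsc i j hij ε hε
end

section
/- If H is a negative-diagonal sign-nonsingular sign pattern allowing symplectic pairs whose digraph D(H) is strongly connected, and D(H) is a proper subdigraph of a noneven digraph D' on the same vertex set (i.e., D' is noneven and contains all arcs of D(H) plus at least one more), then a contradiction arises: no such H exists. Equivalently, a strongly connected noneven digraph that is not maximal (some arc can be added keeping it noneven) does not allow symplectic pairs. -/
open Matrix

def sgnZ (x : ZMod 2) : ℝ := if x = 0 then 1 else -1

lemma sgnZ_add (x y : ZMod 2) : sgnZ (x + y) = sgnZ x * sgnZ y := by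
  have h01 : ∀ z : ZMod 2, z = 0 ∨ z = 1 := by decide
  have h11 : (1 : ZMod 2) + 1 = 0 := by decide
  rcases h01 x with rfl | rfl <;> rcases h01 y with rfl | rfl <;> simp [sgnZ, h11]

lemma sgnZ_sum {ι : Type*} (t : Finset ι) (f : ι → ZMod 2) :
    sgnZ (∑ i ∈ t, f i) = ∏ i ∈ t, sgnZ (f i) := by
  classical
  induction t using Finset.induction_on with
  | empty => simp [sgnZ]
  | insert a t ha ih => rw [Finset.sum_insert ha, Finset.prod_insert ha, sgnZ_add, ih]

def sg {n : ℕ} (w : Fin n → Fin n → ZMod 2) (i j : Fin n) : ℝ :=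
  if i = j then -1 else sgnZ (w i j)

lemma sg_sq {n : ℕ} (w : Fin n → Fin n → ZMod 2) (i j : Fin n) : sg w i j = 1 ∨ sg w i j = -1 := by
  unfold sg sgnZ
  split_ifs <;> simp

lemma perm_term_aux {n : ℕ} (R : Fin n → Fin n → Prop) (w : Fin n → Fin n → ZMod 2)
    (hw : ∀ (m : ℕ) (c : Fin (m+1) → Fin n), DicycleOn R c → ∑ i, w (c i) (c (i+1)) = 1)
    (σ : Equiv.Perm (Fin n)) : (∀ i, σ i ≠ i → R i (σ i)) →
    ((Equiv.Perm.sign σ : ℤ) : ℝ) * ∏ i, (- sg w i (σ i)) = 1 := by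
  induction σ using Equiv.Perm.cycle_induction_on with
  | base_one => intro _; simp [sg]
  | base_cycles σ hσ =>
    intro h
    obtain ⟨x, hx, -⟩ := id hσ
    have hxs : x ∈ σ.support := by simpa using hx
    have hon : σ.IsCycleOn (σ.support : Set (Fin n)) := by
      rw [Equiv.Perm.coe_support_eq_set_support]; exact Equiv.Perm.IsCycle.isCycleOn hσ
    have hpos : 0 < σ.support.card := Finset.card_pos.mpr ⟨x, hxs⟩
    obtain ⟨m, hm⟩ : ∃ m, σ.support.card = m + 1 := ⟨_, (Nat.succ_pred_eq_of_pos hpos).symm⟩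
    set c : Fin (m+1) → Fin n := fun i => (σ ^ (i : ℕ)) x with hc
    have hinj : Function.Injective c := by
      intro i j hij
      have := (hon.pow_apply_eq_pow_apply hxs).1 hij
      rw [hm] at this
      apply Fin.ext
      have h1 := Nat.mod_eq_of_lt i.2
      have h2 := Nat.mod_eq_of_lt j.2
      unfold Nat.ModEq at this
      omega
    have hnext : ∀ i, c (i+1) = σ (c i) := by
      intro i
      have : σ (c i) = (σ ^ ((i:ℕ)+1)) x := by
        simp [hc, pow_succ', Equiv.Perm.mul_apply]
      rw [this]
      refine (hon.pow_apply_eq_pow_apply hxs).2 ?_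
      rw [hm]
      unfold Nat.ModEq
      rw [Fin.val_add]
      simp
    have hsupp : ∀ i, c i ∈ σ.support := by
      intro i
      simpa [hc] using hx
    have himg : Finset.univ.image c = σ.support := by
      apply Finset.eq_of_subset_of_card_le
      · intro y hy
        obtain ⟨i, -, rfl⟩ := Finset.mem_image.1 hy
        exact hsupp i
      · rw [Finset.card_image_of_injective _ hinj, hm]; simp
    have hcyc : DicycleOn R c := by
      refine ⟨hinj, fun i => ?_⟩
      rw [hnext]
      exact h _ (Equiv.Perm.mem_support.1 (hsupp i))
    have hsum := hw m c hcyc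
    have hprod : ∏ i, (- sg w i (σ i)) = ∏ i ∈ σ.support, (- sg w i (σ i)) := by
      symm
      apply Finset.prod_subset (Finset.subset_univ _)
      intro i _ hi
      have : σ i = i := by simpa using hi
      simp [this, sg]
    rw [hprod, ← himg, Finset.prod_image (fun a _ b _ h => hinj h)]
    have h3 : ∀ i, - sg w (c i) (σ (c i)) = - sgnZ (w (c i) (c (i+1))) := by
      intro i
      have : c i ≠ σ (c i) := (Equiv.Perm.mem_support.1 (hsupp i)).symm
      simp [sg, this, hnext]
    rw [Finset.prod_congr rfl (fun i _ => h3 i), Finset.prod_neg, ← sgnZ_sum, hsum, hσ.sign, hm]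
    simp [sgnZ, ← pow_add, ← mul_pow]
  | induction_disjoint σ τ hd hc ih1 ih2 =>
    intro h
    have key : ∀ i, (σ i = i ∧ (σ * τ) i = τ i) ∨ (τ i = i ∧ (σ * τ) i = σ i) := by
      intro i
      rcases hd i with h1 | h1
      · left; refine ⟨h1, ?_⟩
        rw [hd.commute.eq, Equiv.Perm.mul_apply, h1]
      · right; refine ⟨h1, ?_⟩
        rw [Equiv.Perm.mul_apply, h1]
    have i1 := ih1 (fun i hi => by
      rcases key i with ⟨h1, h2⟩ | ⟨h1, h2⟩
      · exact absurd h1 hi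
      · rw [← h2]; exact h i (by rw [h2]; exact hi))
    have i2 := ih2 (fun i hi => by
      rcases key i with ⟨h1, h2⟩ | ⟨h1, h2⟩
      · rw [← h2]; exact h i (by rw [h2]; exact hi)
      · exact absurd h1 hi)
    have : ∏ i, (- sg w i ((σ * τ) i)) = (∏ i, (- sg w i (σ i))) * ∏ i, (- sg w i (τ i)) := by
      rw [← Finset.prod_mul_distrib]
      refine Finset.prod_congr rfl fun i _ => ?_
      rcases key i with ⟨h1, h2⟩ | ⟨h1, h2⟩
      · rw [h1, h2]; simp [sg]
      · rw [h1, h2]; simp [sg]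
    rw [this, Equiv.Perm.sign_mul]
    push_cast
    calc _ = (((Equiv.Perm.sign σ : ℤ) : ℝ) * ∏ i, (- sg w i (σ i))) *
          (((Equiv.Perm.sign τ : ℤ) : ℝ) * ∏ i, (- sg w i (τ i))) := by ring
      _ = 1 := by rw [i1, i2]; norm_num

lemma perm_term {n : ℕ} (R : Fin n → Fin n → Prop) (w : Fin n → Fin n → ZMod 2)
    (hw : ∀ (m : ℕ) (c : Fin (m+1) → Fin n), DicycleOn R c → ∑ i, w (c i) (c (i+1)) = 1)
    (σ : Equiv.Perm (Fin n)) (h : ∀ i, σ i ≠ i → R i (σ i)) :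
    ((Equiv.Perm.sign σ : ℤ) : ℝ) * ∏ i, sg w i (σ i) = (-1) ^ n := by
  have := perm_term_aux R w hw σ h
  rw [Finset.prod_neg] at this
  simp only [Finset.card_univ, Fintype.card_fin] at this
  have h2 : ((-1:ℝ)^n) * (-1)^n = 1 := by rw [← mul_pow]; norm_num
  linear_combination ((-1:ℝ)^n) * this - ((Equiv.Perm.sign σ : ℤ) : ℝ) * (∏ i, sg w i (σ i)) * h2

lemma det_formula {n : ℕ} (R : Fin n → Fin n → Prop) (w : Fin n → Fin n → ZMod 2)
    (hw : ∀ (m : ℕ) (c : Fin (m+1) → Fin n), DicycleOn R c → ∑ i, w (c i) (c (i+1)) = 1)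
    (N : Matrix (Fin n) (Fin n) ℝ) (h1 : ∀ i j, N i j = sg w i j * |N i j|)
    (h2 : ∀ i j, N i j ≠ 0 → i ≠ j → R i j) :
    N.det = (-1) ^ n * ∑ σ : Equiv.Perm (Fin n), ∏ i, |N i (σ i)| := by
  rw [← Matrix.det_transpose, Matrix.det_apply', Finset.mul_sum]
  refine Finset.sum_congr rfl fun σ _ => ?_
  simp only [Matrix.transpose_apply]
  by_cases hz : ∏ i, N i (σ i) = 0
  · rw [hz, ← Finset.abs_prod, hz]; simp
  · have hs : ∀ i, N i (σ i) ≠ 0 := fun i => (Finset.prod_ne_zero_iff.1 hz) i (Finset.mem_univ _)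
    have e : ∏ i, N i (σ i) = (∏ i, sg w i (σ i)) * ∏ i, |N i (σ i)| := by
      rw [← Finset.prod_mul_distrib]
      exact Finset.prod_congr rfl fun i _ => h1 _ _
    rw [e, ← mul_assoc, perm_term R w hw σ (fun i hi => h2 _ _ (hs i) (Ne.symm hi))]

lemma det_two_rows {n : ℕ} (u v : Fin n → ℝ) (i k : Fin n) (hik : i ≠ k) :
    (((1 : Matrix (Fin n) (Fin n) ℝ).updateRow i u).updateRow k v).det = u i * v k - u k * v i := by
  have e : (((1 : Matrix (Fin n) (Fin n) ℝ).updateRow i u).updateRow k v)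
      = 1 + (Matrix.of fun r (t : Fin 2) => if r = (![i, k] t) then (1:ℝ) else 0) *
        (Matrix.of fun (t : Fin 2) r => (![u, v] t) r - if r = (![i, k] t) then (1:ℝ) else 0) := by
    ext r t
    simp only [Matrix.add_apply, Matrix.mul_apply, Fin.sum_univ_two, Matrix.updateRow_apply,
      Matrix.one_apply, Matrix.of_apply]
    by_cases h1 : r = k
    · subst h1
      simp [hik.symm, eq_comm]
    · by_cases h2 : r = i
      · subst h2
        simp [hik, eq_comm]
      · simp [h1, h2]
  rw [e, Matrix.det_one_add_mul_comm, Matrix.det_fin_two]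
  simp only [Matrix.mul_apply, Matrix.add_apply, Matrix.of_apply, mul_ite, mul_one, mul_zero, Finset.sum_ite_eq', Finset.sum_ite_eq,
    Finset.mem_univ, if_true]
  simp [hik, hik.symm]

/-- 2x2 Jacobi: a nonvanishing minor of the inverse transpose yields a complementary matching. -/
lemma exists_matching {n : ℕ} (A D : Matrix (Fin n) (Fin n) ℝ) (hAD : A * Dᵀ = 1)
    (i k j l : Fin n) (hik : i ≠ k) (hd : D i j * D k l - D k j * D i l ≠ 0) :
    ∃ σ : Equiv.Perm (Fin n), σ i = j ∧ σ k = l ∧ ∀ r, r ≠ i → r ≠ k → A r (σ r) ≠ 0 := by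
  set M := (A.updateRow i (Pi.single j 1)).updateRow k (Pi.single l 1) with hM
  have e : M * Dᵀ = ((1 : Matrix (Fin n) (Fin n) ℝ).updateRow i (fun r => D r j)).updateRow k
      (fun r => D r l) := by
    ext r t
    have := congrFun (congrFun hAD r) t
    simp only [hM, Matrix.updateRow_mul]
    by_cases h1 : r = k
    · subst h1; simp
    · by_cases h2 : r = i
      · subst h2; simp [Matrix.updateRow_apply, h1]
      · simp [Matrix.updateRow_apply, h1, h2, this]
  have hdet : M.det ≠ 0 := by
    intro h0
    have := congrArg Matrix.det e
    rw [Matrix.det_mul, h0, zero_mul, det_two_rows _ _ _ _ hik] at this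
    exact hd (by linarith)
  rw [← Matrix.det_transpose, Matrix.det_apply'] at hdet
  obtain ⟨σ, -, hσ⟩ := Finset.exists_ne_zero_of_sum_ne_zero hdet
  have hs : ∀ r, M r (σ r) ≠ 0 := fun r =>
    (Finset.prod_ne_zero_iff.1 (right_ne_zero_of_mul hσ)) r (Finset.mem_univ _)
  refine ⟨σ, ?_, ?_, ?_⟩
  · have := hs i
    simp only [hM, Matrix.updateRow_apply, hik, if_true, if_false, Pi.single_apply] at this
    by_contra hc; simp [hc] at this
  · have := hs k
    simp only [hM, Matrix.updateRow_apply, if_true, Pi.single_apply] at this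
    by_contra hc; simp [hc] at this
  · intro r h1 h2
    simpa [hM, Matrix.updateRow_apply, h1, h2] using hs r

lemma sum_resign {n : ℕ} (t p : Fin n → ℝ) (hp : ∀ j, p j = 1 ∨ p j = -1) (h0 : ∑ j, t j = 0)
    (h : ∀ j l, t j ≠ 0 → t l ≠ 0 → p j = p l → 0 < t j * t l) : ∑ j, p j * |t j| = 0 := by
  by_cases hall : ∀ j, t j = 0
  · simp [hall]
  · push Not at hall
    obtain ⟨j0, hj0⟩ := hall
    obtain ⟨a, -, ha⟩ := Finset.exists_pos_of_sum_zero_of_exists_nonzero t h0 ⟨j0, Finset.mem_univ _, hj0⟩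
    have h0' : ∑ j, (- t j) = 0 := by rw [Finset.sum_neg_distrib, h0, neg_zero]
    obtain ⟨b, -, hb⟩ := Finset.exists_pos_of_sum_zero_of_exists_nonzero (fun j => - t j) h0'
      ⟨j0, Finset.mem_univ _, neg_ne_zero.2 hj0⟩
    have hb' : t b < 0 := by linarith
    have hab : p a ≠ p b := fun hc => by
      have := h a b ha.ne' hb'.ne hc
      nlinarith
    have : ∀ j, p j * |t j| = p a * t j := by
      intro j
      by_cases hj : t j = 0
      · simp [hj]
      · by_cases hc : p a = p j
        · have h1 := h a j ha.ne' hj hc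
          have : 0 < t j := pos_of_mul_pos_right h1 ha.le
          rw [abs_of_pos this, hc]
        · have hc2 : p b = p j := by
            rcases hp a with h1 | h1 <;> rcases hp b with h2 | h2 <;> rcases hp j with h3 | h3 <;>
              simp_all
          have hc3 : p j = - p a := by
            rcases hp a with h1 | h1 <;> rcases hp j with h3 | h3 <;> simp_all
          have h1 := h b j hb'.ne hj hc2
          have : t j < 0 := by nlinarith
          rw [abs_of_neg this, hc3]; ring
    rw [Finset.sum_congr rfl (fun j _ => this j), ← Finset.mul_sum, h0, mul_zero]

lemma exists_nodup_path {n : ℕ} (R : Fin n → Fin n → Prop) (b x : Fin n)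
    (h : Relation.ReflTransGen R b x) :
    ∃ l : List (Fin n), (b :: l).Nodup ∧ (b :: l).IsChain R ∧ (b :: l).getLast (by simp) = x := by
  induction h with
  | refl => exact ⟨[], by simp, by simp, by simp⟩
  | @tail y z _ hyz ih =>
    obtain ⟨l, h1, h2, h3⟩ := ih
    by_cases hz : z ∈ b :: l
    · obtain ⟨s, t, hst⟩ := List.append_of_mem hz
      have hst' : b :: l = (s ++ [z]) ++ t := by simp [hst]
      rw [hst'] at h1 h2
      cases s with
      | nil =>
        simp at hst
        obtain ⟨rfl, -⟩ := hst
        exact ⟨[], by simp, by simp, by simp⟩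
      | cons b' s =>
        simp at hst
        obtain ⟨rfl, -⟩ := hst
        refine ⟨s ++ [z], (List.nodup_append.1 h1).1, (List.isChain_append.1 h2).1, by simp⟩
    · refine ⟨l ++ [z], ?_, ?_, by simp⟩
      · rw [← List.cons_append, List.nodup_append]
        refine ⟨h1, by simp, ?_⟩
        intro u hu v hv
        simp at hv
        subst hv
        rintro rfl
        exact hz hu
      · rw [← List.cons_append, List.isChain_append]
        refine ⟨h2, by simp, ?_⟩
        intro u hu v hv
        rw [List.getLast?_eq_getLast_of_ne_nil (by simp), h3] at hu
        simp at hu hv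
        subst hu; subst hv
        exact hyz

lemma exists_path_perm {n : ℕ} (R : Fin n → Fin n → Prop) (b a : Fin n)
    (h : Relation.ReflTransGen R b a) :
    ∃ σ : Equiv.Perm (Fin n), σ a = b ∧ ∀ r, r ≠ a → σ r = r ∨ R r (σ r) := by
  obtain ⟨l, h1, h2, h3⟩ := exists_nodup_path R b a h
  refine ⟨(b :: l).formPerm, ?_, ?_⟩
  · conv_lhs => rw [← h3]
    exact List.formPerm_apply_getLast _ _
  · intro r hr
    by_cases hm : r ∈ b :: l
    · right
      obtain ⟨i, hi, rfl⟩ := List.getElem_of_mem hm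
      have hlt : i + 1 < (b :: l).length := by
        by_contra hc
        apply hr
        rw [← h3, List.getLast_eq_getElem]
        congr 1
        omega
      rw [List.formPerm_apply_lt_getElem _ h1 _ hlt]
      exact List.isChain_iff_getElem.1 h2 i hlt
    · left; exact List.formPerm_apply_of_notMem hm

/-- a strongly connected noneven digraph that is a proper subdigraph of
a noneven digraph on the same vertex set (i.e. is not maximal) does not allow
symplectic pairs. -/
theorem stmt15 {n : ℕ} (R : Fin n → Fin n → Prop) (hirr : Irreflexive R)
    (hstrong : StronglyConnected R) (hne : IsNoneven R)
    (hnotmax : ∃ R' : Fin n → Fin n → Prop, Irreflexive R' ∧ IsNoneven R' ∧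
      (∀ u v, R u v → R' u v) ∧ ∃ a b, R' a b ∧ ¬ R a b) :
    ¬ DigraphAllowsSymplecticPairs R := by
  obtain ⟨R', hirr', ⟨w, hw⟩, hsub, a, b, hab', hab⟩ := hnotmax
  rintro ⟨H, hH, hneg, hpat, A, D, hA, hD, hAD⟩
  have hne_ab : a ≠ b := by rintro rfl; exact hirr' a hab'
  -- supports
  have hAz : ∀ i j, A i j = 0 ↔ H i j = 0 := fun i j => by rw [← hA i j, Real.sign_eq_zero_iff]
  have hDz : ∀ i j, D i j = 0 ↔ H i j = 0 := fun i j => by rw [← hD i j, Real.sign_eq_zero_iff]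
  have hsupp : ∀ i j, H i j ≠ 0 → i ≠ j → R i j := fun i j h hij => (hpat i j hij).1 h
  have hDA : A * Dᵀ = 1 := by
    have h1 : D * Aᵀ = 1 := mul_eq_one_comm.1 hAD
    have h2 := congrArg Matrix.transpose h1
    simpa [Matrix.transpose_mul] using h2
  have hpos : ∀ x y : ℝ, Real.sign x = Real.sign y → x ≠ 0 → 0 < x * y := by
    intro x y h hx
    rcases lt_or_gt_of_ne hx with hx | hx
    · rw [Real.sign_of_neg hx] at h
      have hy : y < 0 := by
        by_contra hc
        rcases (not_lt.1 hc).eq_or_lt with h0 | h0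
        · rw [← h0, Real.sign_zero] at h; norm_num at h
        · rw [Real.sign_of_pos h0] at h; norm_num at h
      exact mul_pos_of_neg_of_neg hx hy
    · rw [Real.sign_of_pos hx] at h
      have hy : 0 < y := by
        by_contra hc
        rcases (not_lt.1 hc).eq_or_lt with h0 | h0
        · rw [h0, Real.sign_zero] at h; norm_num at h
        · rw [Real.sign_of_neg h0] at h; norm_num at h
      exact mul_pos hx hy
  have hADpos : ∀ i j, H i j ≠ 0 → 0 < A i j * D i j := fun i j h =>
    hpos _ _ ((hA i j).trans (hD i j).symm) (fun h0 => h ((hAz i j).1 h0))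
  -- key
  have key : ∀ i k j l, i ≠ k → j ≠ l → H i j ≠ 0 → H k j ≠ 0 → H i l ≠ 0 → H k l ≠ 0 →
      sg w i j * sg w k j = sg w i l * sg w k l → D i j * D k l = D k j * D i l := by
    intro i k j l hik hjl hij hkj hil hkl hs
    by_contra hc
    obtain ⟨σ, h1, h2, h3⟩ := exists_matching A D hDA i k j l hik (sub_ne_zero.2 hc)
    have hσ : ∀ r, σ r ≠ r → R' r (σ r) := by
      intro r hr
      apply hsub
      apply hsupp _ _ _ (Ne.symm hr)
      by_cases hi : r = i
      · rw [hi, h1]; exact hij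
      · by_cases hk : r = k
        · rw [hk, h2]; exact hkl
        · exact fun h0 => h3 r hi hk ((hAz _ _).2 h0)
    have e1 : (σ * Equiv.swap i k) i = l := by simp [h2]
    have e2 : (σ * Equiv.swap i k) k = j := by simp [h1]
    have e3 : ∀ r, r ≠ i → r ≠ k → (σ * Equiv.swap i k) r = σ r := fun r hi hk => by
      simp [Equiv.swap_apply_of_ne_of_ne hi hk]
    have hτ : ∀ r, (σ * Equiv.swap i k) r ≠ r → R' r ((σ * Equiv.swap i k) r) := by
      intro r hr
      apply hsub
      apply hsupp _ _ _ (Ne.symm hr)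
      by_cases hi : r = i
      · rw [hi, e1]; exact hil
      · by_cases hk : r = k
        · rw [hk, e2]; exact hkj
        · rw [e3 r hi hk]; exact fun h0 => h3 r hi hk ((hAz _ _).2 h0)
    have t1 := perm_term R' w hw σ hσ
    have t2 := perm_term R' w hw _ hτ
    have hk' : k ∈ Finset.univ.erase i := by simp [hik.symm]
    rw [← Finset.mul_prod_erase _ _ (Finset.mem_univ i), ← Finset.mul_prod_erase _ _ hk', h1, h2]
      at t1
    rw [← Finset.mul_prod_erase _ _ (Finset.mem_univ i), ← Finset.mul_prod_erase _ _ hk', e1, e2,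
      Equiv.Perm.sign_mul, Equiv.Perm.sign_swap hik] at t2
    have e4 : ∏ r ∈ (Finset.univ.erase i).erase k, sg w r ((σ * Equiv.swap i k) r)
        = ∏ r ∈ (Finset.univ.erase i).erase k, sg w r (σ r) := by
      refine Finset.prod_congr rfl fun r hr => ?_
      simp only [Finset.mem_erase] at hr
      rw [e3 r hr.2.1 hr.1]
    rw [e4] at t2
    push_cast at t2
    have hu : sg w i l * sg w k j = sg w i j * sg w k l := by
      rcases sg_sq w i j with q1 | q1 <;> rcases sg_sq w k j with q2 | q2 <;>
      rcases sg_sq w i l with q3 | q3 <;> rcases sg_sq w k l with q4 | q4 <;>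
      rw [q1, q2, q3, q4] at hs ⊢ <;> first | (exfalso; norm_num at hs; done) | norm_num
    have hz : (2:ℝ) * (-1) ^ n = 0 := by
      linear_combination -t1 - t2 - ((Equiv.Perm.sign σ : ℤ) : ℝ) *
        (∏ r ∈ (Finset.univ.erase i).erase k, sg w r (σ r)) * hu
    have : ((-1:ℝ)) ^ n ≠ 0 := pow_ne_zero _ (by norm_num)
    exact this (by linarith)
  -- resigned matrices
  set A' : Matrix (Fin n) (Fin n) ℝ := Matrix.of fun i j => sg w i j * |A i j| with hA'
  set D' : Matrix (Fin n) (Fin n) ℝ := Matrix.of fun i j => sg w i j * |D i j| with hD'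
  have hAD' : A' * D'ᵀ = 1 := by
    ext i k
    have h0 := congrFun (congrFun hDA i) k
    rw [Matrix.mul_apply] at h0 ⊢
    simp only [Matrix.transpose_apply, hA', hD', Matrix.of_apply] at h0 ⊢
    by_cases hik : i = k
    · subst hik
      rw [← h0]
      refine Finset.sum_congr rfl fun j _ => ?_
      have h1 : sg w i j * sg w i j = 1 := by
        rcases sg_sq w i j with h | h <;> rw [h] <;> norm_num
      have h2 : |A i j| * |D i j| = A i j * D i j := by
        rw [← abs_mul]
        by_cases hz : H i j = 0
        · rw [(hAz i j).2 hz]; simp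
        · exact abs_of_pos (hADpos i j hz)
      linear_combination |A i j| * |D i j| * h1 + h2
    · rw [Matrix.one_apply_ne hik] at h0 ⊢
      have := sum_resign (fun j => A i j * D k j) (fun j => sg w i j * sg w k j) ?_ h0 ?_
      · rw [← this]
        refine Finset.sum_congr rfl fun j _ => ?_
        simp only [abs_mul]
        ring
      · intro j
        rcases sg_sq w i j with q1 | q1 <;> rcases sg_sq w k j with q2 | q2 <;>
          simp only [q1, q2] <;> norm_num
      · intro j l hj hl hp
        change A i j * D k j ≠ 0 at hj
        change A i l * D k l ≠ 0 at hl
        change sg w i j * sg w k j = sg w i l * sg w k l at hp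
        change 0 < A i j * D k j * (A i l * D k l)
        by_cases hjl : j = l
        · subst hjl; exact mul_self_pos.2 hj
        have a1 : H i j ≠ 0 := fun h => left_ne_zero_of_mul hj ((hAz _ _).2 h)
        have a2 : H k j ≠ 0 := fun h => right_ne_zero_of_mul hj ((hDz _ _).2 h)
        have a3 : H i l ≠ 0 := fun h => left_ne_zero_of_mul hl ((hAz _ _).2 h)
        have a4 : H k l ≠ 0 := fun h => right_ne_zero_of_mul hl ((hDz _ _).2 h)
        have hk := key i k j l hik hjl a1 a2 a3 a4 hp
        have p1 := hADpos i j a1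
        have p3 := hADpos i l a3
        have d1 : D i j ≠ 0 := fun h => a1 ((hDz _ _).1 h)
        have d3 : D i l ≠ 0 := fun h => a3 ((hDz _ _).1 h)
        have d4 : D k l ≠ 0 := fun h => a4 ((hDz _ _).1 h)
        have hpp : 0 < (A i j * D i j) * (A i l * D i l) * (D i j * D k l) ^ 2 := by positivity
        have e : (A i j * D i j) * (A i l * D i l) * (D i j * D k l) ^ 2
            = (A i j * D k j * (A i l * D k l)) * (D i j * D i l) ^ 2 := by
          linear_combination (A i j * D i j) * (A i l * D i l) * (D i j * D k l) * hk
        rw [e] at hpp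
        exact pos_of_mul_pos_left hpp (sq_nonneg _)
  have hHab : H a b = 0 := by
    by_contra h
    exact hab (hsupp a b h hne_ab)
  have hadj : A'.adjugate = A'.det • D'ᵀ := by
    have h1 : A'.adjugate * (A' * D'ᵀ) = A'.det • D'ᵀ := by
      rw [← Matrix.mul_assoc, Matrix.adjugate_mul, Matrix.smul_mul, Matrix.one_mul]
    rwa [hAD', Matrix.mul_one] at h1
  have hz : A'.adjugate b a = 0 := by
    rw [hadj]
    simp [hD', (hDz a b).2 hHab]
  rw [Matrix.adjugate_apply] at hz
  set N := A'.updateRow a (sg w a b • Pi.single b (1:ℝ)) with hN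
  have hNdet : N.det = 0 := by rw [hN, Matrix.det_updateRow_smul, hz, mul_zero]
  have hsgabs : ∀ i j, |sg w i j| = 1 := fun i j => by
    rcases sg_sq w i j with h | h <;> rw [h] <;> norm_num
  have hform := det_formula R' w hw N ?_ ?_
  · rw [hNdet] at hform
    have hs0 : ∑ σ : Equiv.Perm (Fin n), ∏ i, |N i (σ i)| = 0 := by
      rcases mul_eq_zero.1 hform.symm with h | h
      · exact absurd h (pow_ne_zero _ (by norm_num))
      · exact h
    rw [Finset.sum_eq_zero_iff_of_nonneg
      (fun σ _ => Finset.prod_nonneg fun i _ => abs_nonneg _)] at hs0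
    obtain ⟨σ, h1, h2⟩ := exists_path_perm R b a (hstrong b a)
    have h3 := hs0 σ (Finset.mem_univ _)
    obtain ⟨r, -, hr⟩ := Finset.prod_eq_zero_iff.1 h3
    rw [abs_eq_zero] at hr
    have hsgne : ∀ i j, sg w i j ≠ 0 := fun i j h => by
      have := hsgabs i j; rw [h] at this; norm_num at this
    by_cases hra : r = a
    · rw [hra, h1] at hr
      simp [hN] at hr
      exact hsgne a b hr
    · rw [hN, Matrix.updateRow_ne hra] at hr
      simp only [hA', Matrix.of_apply, mul_eq_zero, abs_eq_zero, hsgne, false_or] at hr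
      rw [hAz] at hr
      rcases h2 r hra with h4 | h4
      · rw [h4, hneg] at hr; norm_num at hr
      · have : r ≠ σ r := fun h => by rw [← h] at h4; exact hirr r h4
        exact ((hpat _ _ this).2 h4) hr
  · intro i j
    by_cases hi : i = a
    · subst hi
      by_cases hj : j = b
      · subst hj; simp [hN, hsgabs]
      · simp [hN, hj]
    · rw [hN, Matrix.updateRow_ne hi]
      simp [hA', abs_mul, hsgabs]
  · intro i j h hij
    by_cases hi : i = a
    · subst hi
      by_cases hj : j = b
      · subst hj; exact hab'
      · simp [hN, hj] at h
    · rw [hN, Matrix.updateRow_ne hi] at h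
      apply hsub
      apply hsupp _ _ _ hij
      intro h0
      apply h
      simp [hA', (hAz i j).2 h0]
end
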